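/- arXiv:2204.13833 — 13 statements merged into one kernel-verified Lean document; each statement's English description precedes it below -/
import Mathlib

section
/- Let U be a monoid and let S be a monoid acting monoidally on U on the left by semigroup morphisms (so 1•u = u, (st)•u = s•(t•u), s•(uv) = (s•u)(s•v)); write s⁺ = s•1, and form the semidirect product U ⋊ S on U × S with (u, s)(v, t) = (u(s•v), st). Then M = {(u, s) ∈ U × S : u = u·s⁺} is a subsemigroup of U ⋊ S, the map F : U ⋊ S → M defined by F(u, s) = (u·s⁺, s) is a homomorphism which fixes every element of M (a retraction onto M), and M is a monoid with identity element (1, 1). -/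
/-- The semidirect multiplication on `U × S` induced by a left action of `S` on `U`:
`(u, s)(v, t) = (u·(s•v), st)`. -/
def sdMul {U S : Type*} [Monoid U] [Monoid S] (act : S → U → U) (p q : U × S) : U × S :=
  (p.1 * act p.2 q.1, p.2 * q.2)

/-- The subset `M = {(u, s) : u = u·s⁺}` of the semidirect product, where `s⁺ = s•1`. -/
def sdM {U S : Type*} [Monoid U] [Monoid S] (act : S → U → U) : Set (U × S) :=
  {p | p.1 = p.1 * act p.2 1}

/-- The retraction `F(u, s) = (u·s⁺, s)`. -/
def sdRetr {U S : Type*} [Monoid U] [Monoid S] (act : S → U → U) (p : U × S) : U × S :=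
  (p.1 * act p.2 1, p.2)

/-- For monoids `U, S` with `S` acting monoidally on `U` by semigroup
morphisms, `M = {(u, s) : u = u·s⁺}` is a subsemigroup of `U ⋊ S`, the map
`F(u, s) = (u·s⁺, s)` is a homomorphism of `U ⋊ S` onto `M` fixing `M` pointwise
(a retraction), and `M` is a monoid with identity `(1, 1)`. -/
theorem stmt_5 {U S : Type*} [Monoid U] [Monoid S]
    (act : S → U → U)
    (hone : ∀ u : U, act 1 u = u)
    (hcomp : ∀ (s t : S) (u : U), act (s * t) u = act s (act t u))
    (hhom : ∀ (s : S) (u v : U), act s (u * v) = act s u * act s v) :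
    (∀ p ∈ sdM act, ∀ q ∈ sdM act, sdMul act p q ∈ sdM act) ∧
    (∀ p : U × S, sdRetr act p ∈ sdM act) ∧
    (∀ p q : U × S, sdRetr act (sdMul act p q) = sdMul act (sdRetr act p) (sdRetr act q)) ∧
    (∀ p ∈ sdM act, sdRetr act p = p) ∧
    (1, 1) ∈ sdM act ∧
    (∀ p ∈ sdM act, sdMul act (1, 1) p = p ∧ sdMul act p (1, 1) = p) ∧
    (∀ p q r : U × S, sdMul act (sdMul act p q) r = sdMul act p (sdMul act q r)) := by
  have act_one_mul (s : S) (u : U) : act s 1 * act s u = act s u := by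
    rw [← hhom, one_mul]
  have act_mul_act_one (s t : S) (v : U) :
      act s v * act (s * t) 1 = act s (v * act t 1) := by
    rw [hcomp, hhom]
  refine ⟨?_, ?_, ?_, ?_, ?_, ?_, ?_⟩
  · rintro ⟨u, s⟩ - ⟨v, t⟩ (hq : v = v * act t 1)
    change u * act s v = u * act s v * act (s * t) 1
    rw [mul_assoc, act_mul_act_one, ← hq]
  · rintro ⟨u, s⟩
    change u * act s 1 = u * act s 1 * act s 1
    rw [mul_assoc, act_one_mul]
  · rintro ⟨u, s⟩ ⟨v, t⟩
    simp only [sdRetr, sdMul, mul_assoc, act_mul_act_one, act_one_mul]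
  · rintro ⟨u, s⟩ (hp : u = u * act s 1)
    exact Prod.ext hp.symm rfl
  · simp [sdM, hone]
  · rintro ⟨u, s⟩ (hp : u = u * act s 1)
    simp [sdMul, hone, ← hp]
  · rintro ⟨u, s⟩ ⟨v, t⟩ ⟨w, r⟩
    simp only [sdMul, hhom, hcomp, mul_assoc]
end

section
/- Let M be a monoid with identity 1, let U and S be subsemigroups of M, and write U¹ = U ∪ {1}. Then the following are equivalent: (a) (U, S) is an action pair, i.e. there exists a left action of S on U¹ by semigroup morphisms ((s, u) ↦ s•u with s•u ∈ U¹, (st)•u = s•(t•u), s•(uv) = (s•u)(s•v)) satisfying (A1) su = (s•u)s for all s ∈ S, u ∈ U¹, and (A2) us = vt ⟹ u(s•1) = v(t•1) for all u, v ∈ U¹ and s, t ∈ S; (b) (SA1) sU¹ ⊆ U¹s holds for all s ∈ S (i.e. for all s ∈ S, u ∈ U¹ there is v ∈ U¹ with su = vs), and there exists a map S → U¹, s ↦ s⁺, satisfying (+1) s = s⁺s for all s ∈ S, (+2) st⁺ = (st)⁺s for all s, t ∈ S, (+3) (st)⁺ = (st)⁺s⁺ for all s, t ∈ S, and (+4)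 us = vt ⟹ us⁺ = vt⁺ for all u, v ∈ U¹ and s, t ∈ S. -/
/-- For subsemigroups `U, S` of a monoid `M` with `U¹ = U ∪ {1}`, the pair
`(U, S)` is an action pair (there is a left action of `S` on `U¹` by semigroup morphisms
satisfying (A1) `su = (s•u)s` and (A2) `us = vt ⟹ u(s•1) = v(t•1)`) if and only if
(SA1) `sU¹ ⊆ U¹s` holds and there is a map `s ↦ s⁺` from `S` to `U¹` satisfying
(+1) `s = s⁺s`, (+2) `st⁺ = (st)⁺s`, (+3) `(st)⁺ = (st)⁺s⁺`, and
(+4) `us = vt ⟹ us⁺ = vt⁺`. -/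
theorem stmt_6 {M : Type*} [Monoid M] (U S : Subsemigroup M) :
    (∃ act : M → M → M,
      (∀ s ∈ S, ∀ u ∈ ((U : Set M) ∪ {1}), act s u ∈ ((U : Set M) ∪ {1})) ∧
      (∀ s ∈ S, ∀ t ∈ S, ∀ u ∈ ((U : Set M) ∪ {1}), act (s * t) u = act s (act t u)) ∧
      (∀ s ∈ S, ∀ u ∈ ((U : Set M) ∪ {1}), ∀ v ∈ ((U : Set M) ∪ {1}),
        act s (u * v) = act s u * act s v) ∧
      (∀ s ∈ S, ∀ u ∈ ((U : Set M) ∪ {1}), s * u = act s u * s) ∧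
      (∀ u ∈ ((U : Set M) ∪ {1}), ∀ v ∈ ((U : Set M) ∪ {1}), ∀ s ∈ S, ∀ t ∈ S,
        u * s = v * t → u * act s 1 = v * act t 1))
    ↔
    ((∀ s ∈ S, ∀ u ∈ ((U : Set M) ∪ {1}), ∃ v ∈ ((U : Set M) ∪ {1}), s * u = v * s) ∧
     ∃ plus : M → M,
      (∀ s ∈ S, plus s ∈ ((U : Set M) ∪ {1})) ∧
      (∀ s ∈ S, s = plus s * s) ∧
      (∀ s ∈ S, ∀ t ∈ S, s * plus t = plus (s * t) * s) ∧
      (∀ s ∈ S, ∀ t ∈ S, plus (s * t) = plus (s * t) * plus s) ∧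
      (∀ u ∈ ((U : Set M) ∪ {1}), ∀ v ∈ ((U : Set M) ∪ {1}), ∀ s ∈ S, ∀ t ∈ S,
        u * s = v * t → u * plus s = v * plus t)) := by
  have one_mem : (1 : M) ∈ (U : Set M) ∪ {1} := Or.inr rfl
  have mul_mem' : ∀ u ∈ (U : Set M) ∪ {1}, ∀ v ∈ (U : Set M) ∪ {1},
      u * v ∈ (U : Set M) ∪ {1} := by
    rintro u (hu | rfl) v (hv | rfl)
    · exact Or.inl (U.mul_mem hu hv)
    · simpa using Or.inr hu
    · simpa using Or.inr hv
    · simp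
  constructor
  · rintro ⟨act, act_mem, act_act, act_mul, hA1, hA2⟩
    refine ⟨fun s hs u hu => ⟨act s u, act_mem s hs u hu, hA1 s hs u hu⟩,
      fun s => act s 1, fun s hs => act_mem s hs 1 one_mem, fun s hs => ?_,
      fun s hs t ht => ?_, fun s hs t ht => ?_, hA2⟩
    · simpa using hA1 s hs 1 one_mem
    · dsimp only
      rw [act_act s hs t ht 1 one_mem]
      exact hA1 s hs _ (act_mem t ht 1 one_mem)
    · dsimp only
      rw [act_act s hs t ht 1 one_mem, ← act_mul s hs _ (act_mem t ht 1 one_mem) 1 one_mem,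
        mul_one]
  · rintro ⟨hSA1, plus, plus_mem, plus_mul, mul_plus, plus_mul_plus, hplus⟩
    have plus_idem : ∀ s ∈ S, plus s * plus s = plus s := fun s hs => by
      simpa using (hplus 1 one_mem (plus s) (plus_mem s hs) s hs s hs
        (by simpa using plus_mul s hs)).symm
    choose! w w_mem hw using hSA1
    -- The action `w s u * plus s` does not depend on the choice of `w s u`.
    obtain ⟨act, hact⟩ : ∃ act : M → M → M, ∀ s u, act s u = w s u * plus s := ⟨_, fun _ _ => rfl⟩
    have act_eq : ∀ s ∈ S, ∀ u ∈ (U : Set M) ∪ {1}, ∀ v ∈ (U : Set M) ∪ {1},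
        s * u = v * s → act s u = v * plus s := fun s hs u hu v hv h => by
      rw [hact]
      exact hplus _ (w_mem s hs u hu) v hv s hs s hs ((hw s hs u hu).symm.trans h)
    have act_mem : ∀ s ∈ S, ∀ u ∈ (U : Set M) ∪ {1}, act s u ∈ (U : Set M) ∪ {1} :=
      fun s hs u hu => by
        rw [hact]
        exact mul_mem' _ (w_mem s hs u hu) _ (plus_mem s hs)
    have act_plus : ∀ s ∈ S, ∀ u, act s u * plus s = act s u := fun s hs u => by
      rw [hact, mul_assoc, plus_idem s hs]
    have hA1 : ∀ s ∈ S, ∀ u ∈ (U : Set M) ∪ {1}, s * u = act s u * s := fun s hs u hu => by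
      rw [hact, mul_assoc, ← plus_mul s hs, hw s hs u hu]
    have act_mul : ∀ s ∈ S, ∀ u ∈ (U : Set M) ∪ {1}, ∀ v ∈ (U : Set M) ∪ {1},
        act s (u * v) = act s u * act s v := fun s hs u hu v hv => by
      rw [act_eq s hs _ (mul_mem' u hu v hv) _
        (mul_mem' _ (act_mem s hs u hu) _ (act_mem s hs v hv)), mul_assoc, act_plus s hs]
      rw [← mul_assoc, hA1 s hs u hu, mul_assoc, hA1 s hs v hv, mul_assoc]
    have act_one : ∀ s ∈ S, act s 1 = plus s := fun s hs => by
      simpa using act_eq s hs 1 one_mem 1 one_mem (by simp)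
    refine ⟨act, act_mem, fun s hs t ht u hu => ?_, act_mul, hA1,
      fun u hu v hv s hs t ht h => ?_⟩
    · have hst := S.mul_mem hs ht
      have htu := act_mem t ht u hu
      have act_plus_eq : act s (plus t) = plus (s * t) := by
        rw [act_eq s hs _ (plus_mem t ht) _ (plus_mem _ hst) (mul_plus s hs t ht),
          ← plus_mul_plus s hs t ht]
      have absorb : act s (act t u) * plus (s * t) = act s (act t u) := by
        rw [← act_plus_eq, ← act_mul s hs _ htu _ (plus_mem t ht), act_plus t ht]
      rw [act_eq (s * t) hst u hu _ (act_mem s hs _ htu), absorb]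
      rw [mul_assoc, hA1 t ht u hu, ← mul_assoc, hA1 s hs _ htu, mul_assoc]
    · rw [act_one s hs, act_one t ht]
      exact hplus u hu v hv s hs t ht h
end

section
/- Let M be a monoid with identity 1, let U and S be subsemigroups of M with U¹ = U ∪ {1}, and suppose (U, S) is a strong action pair, i.e. (SA1) sU¹ ⊆ U¹s for all s ∈ S, and (SA2) for all u, v ∈ U¹ and s, t ∈ S, us = vt implies u = v. Then: (i) U ∩ S ⊆ {1}; (ii) the following are equivalent: 1 ∈ US (i.e. us = 1 for some u ∈ U, s ∈ S); 1 ∈ U ∩ S; U ∩ S = {1}; U ∩ S ≠ ∅. -/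
/-- If `(U, S)` is a strong action pair in a monoid `M`
((SA1) `sU¹ ⊆ U¹s`, (SA2) `us = vt ⟹ u = v` for `u, v ∈ U¹`, `s, t ∈ S`), then:
(i) `U ∩ S ⊆ {1}`; (ii) the conditions `1 ∈ US`, `1 ∈ U ∩ S`, `U ∩ S = {1}` and
`U ∩ S ≠ ∅` are all equivalent. -/
theorem stmt_7 {M : Type*} [Monoid M] (U S : Subsemigroup M)
    (hSA1 : ∀ s ∈ S, ∀ u ∈ ((U : Set M) ∪ {1}), ∃ v ∈ ((U : Set M) ∪ {1}), s * u = v * s)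
    (hSA2 : ∀ u ∈ ((U : Set M) ∪ {1}), ∀ v ∈ ((U : Set M) ∪ {1}), ∀ s ∈ S, ∀ t ∈ S,
      u * s = v * t → u = v) :
    ((U : Set M) ∩ (S : Set M) ⊆ {1}) ∧
    ((∃ u ∈ U, ∃ s ∈ S, u * s = 1) ↔ (1 ∈ U ∧ 1 ∈ S)) ∧
    ((1 ∈ U ∧ 1 ∈ S) ↔ (U : Set M) ∩ (S : Set M) = {1}) ∧
    (((U : Set M) ∩ (S : Set M) = {1}) ↔ ((U : Set M) ∩ (S : Set M)).Nonempty) := by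
  have one_mem : (1 : M) ∈ ((U : Set M) ∪ {1}) := Or.inr rfl
  have eq_one : ∀ x ∈ U, x ∈ S → x = 1 := fun x hxU hxS =>
    hSA2 x (Or.inl hxU) 1 one_mem x hxS (x * x) (S.mul_mem hxS hxS) (one_mul _).symm
  refine ⟨fun x hx => eq_one x hx.1 hx.2, ⟨?_, ?_⟩, ⟨?_, ?_⟩, ⟨?_, ?_⟩⟩
  · rintro ⟨u, hu, s, hs, hus⟩
    obtain ⟨v, hv, hsu⟩ := hSA1 s hs u (Or.inl hu)
    have hv1 : 1 = v := hSA2 1 one_mem v hv s hs (s * s) (S.mul_mem hs hs) (by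
      rw [← mul_assoc, ← hsu, mul_assoc, hus, one_mul, mul_one])
    rw [← hv1, one_mul] at hsu
    have hu1 : u = 1 := by
      calc u = u * s * u := by rw [hus, one_mul]
        _ = 1 := by rw [mul_assoc, hsu, hus]
    subst hu1
    rw [one_mul] at hus
    exact ⟨hu, hus ▸ hs⟩
  · rintro ⟨hU, hS⟩
    exact ⟨1, hU, 1, hS, one_mul 1⟩
  · rintro ⟨hU, hS⟩
    exact Set.eq_singleton_iff_unique_mem.2 ⟨⟨hU, hS⟩, fun x hx => eq_one x hx.1 hx.2⟩
  · intro h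
    exact (Set.eq_singleton_iff_unique_mem.1 h).1
  · intro h
    exact h ▸ Set.singleton_nonempty 1
  · intro h
    exact Set.eq_singleton_iff_nonempty_unique_mem.2 ⟨h, fun x hx => eq_one x hx.1 hx.2⟩
end

section
/- Let M be a monoid with identity 1, let U, S be subsemigroups with U¹ = U ∪ {1}, and let (s, u) ↦ s•u be a left action of S on U¹ by semigroup morphisms satisfying (A1) su = (s•u)s for all s ∈ S, u ∈ U¹; write s⁺ = s•1. Call a pair (u, s) ∈ U × S a natural factorisation of a ∈ US if a = us and u = us⁺. Then: (1) every element of US = {us : u ∈ U, s ∈ S} has a natural factorisation; (2) if (u, s) and (v, t) are natural factorisations of a and b respectively, then (u(s•v), st) is a natural factorisation of ab; (3) if in addition (A2) holds (us = vt ⟹ us⁺ = vt⁺ for u, v ∈ U¹, s, t ∈ S), then any two natural factorisations (u, s) and (v, t) of the same element of US satisfy u = v. -/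
/-- Let `(U, S)` be a weak action pair in a monoid `M` (a left action of `S`
on `U¹ = U ∪ {1}` by semigroup morphisms with (A1) `su = (s•u)s`), and write `s⁺ = s•1`.
A natural factorisation of `a ∈ US` is a pair `(u, s) ∈ U × S` with `a = us` and `u = us⁺`.
Then: (1) every element of `US` has a natural factorisation; (2) if `(u, s)` and `(v, t)` are
natural factorisations of `a` and `b`, then `(u·(s•v), st)` is a natural factorisation of
`ab`; (3) if moreover (A2) holds, then any two natural factorisations of the same element
have the same first coordinate. -/
theorem stmt_10 {M : Type*} [Monoid M] (U S : Subsemigroup M) (act : M → M → M)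
    (hcl : ∀ s ∈ S, ∀ u ∈ ((U : Set M) ∪ {1}), act s u ∈ ((U : Set M) ∪ {1}))
    (hcomp : ∀ s ∈ S, ∀ t ∈ S, ∀ u ∈ ((U : Set M) ∪ {1}), act (s * t) u = act s (act t u))
    (hhom : ∀ s ∈ S, ∀ u ∈ ((U : Set M) ∪ {1}), ∀ v ∈ ((U : Set M) ∪ {1}),
      act s (u * v) = act s u * act s v)
    (hA1 : ∀ s ∈ S, ∀ u ∈ ((U : Set M) ∪ {1}), s * u = act s u * s) :
    (∀ u ∈ U, ∀ s ∈ S, ∃ v ∈ U, ∃ t ∈ S, u * s = v * t ∧ v = v * act t 1) ∧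
    (∀ u ∈ U, ∀ s ∈ S, ∀ v ∈ U, ∀ t ∈ S, u = u * act s 1 → v = v * act t 1 →
      u * act s v ∈ U ∧ (u * s) * (v * t) = (u * act s v) * (s * t) ∧
        u * act s v = (u * act s v) * act (s * t) 1) ∧
    ((∀ u ∈ ((U : Set M) ∪ {1}), ∀ v ∈ ((U : Set M) ∪ {1}), ∀ s ∈ S, ∀ t ∈ S,
        u * s = v * t → u * act s 1 = v * act t 1) →
      ∀ u ∈ U, ∀ s ∈ S, ∀ v ∈ U, ∀ t ∈ S,
        u = u * act s 1 → v = v * act t 1 → u * s = v * t → u = v) := by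
  have one_mem : (1 : M) ∈ (U : Set M) ∪ {1} := Or.inr rfl
  have mul_mem : ∀ u ∈ U, ∀ w ∈ (U : Set M) ∪ {1}, u * w ∈ U := by
    rintro u hu w (hw | rfl)
    · exact U.mul_mem hu hw
    · rwa [mul_one]
  refine ⟨fun u hu s hs => ?_, fun u hu s hs v hv t ht _ hvt => ⟨?_, ?_, ?_⟩,
    fun hA2 u hu s hs v hv t ht hus hvt h => ?_⟩
  · refine ⟨u * act s 1, mul_mem u hu _ (hcl s hs 1 one_mem), s, hs, ?_, ?_⟩
    · rw [mul_assoc, ← hA1 s hs 1 one_mem, mul_one]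
    · rw [mul_assoc, ← hhom s hs 1 one_mem 1 one_mem, mul_one]
  · exact mul_mem u hu _ (hcl s hs v (Or.inl hv))
  · calc (u * s) * (v * t) = u * (s * v) * t := by simp only [mul_assoc]
      _ = (u * act s v) * (s * t) := by
        rw [hA1 s hs v (Or.inl hv)]
        simp only [mul_assoc]
  · rw [hcomp s hs t ht 1 one_mem, mul_assoc,
      ← hhom s hs v (Or.inl hv) _ (hcl t ht 1 one_mem), ← hvt]
  · rw [hus, hvt]
    exact hA2 u (Or.inl hu) v (Or.inl hv) s hs t ht h
end

section
/- Every left restriction monoid has a proper cover. Concretely: let M be a left restriction monoid with projections P = {s⁺ : s ∈ M}, and let C = {(e, s) ∈ P × M : e = e·s⁺}, equipped with the multiplication (e, s)(f, t) = (e·(sf)⁺, st) and the unary operation (e, s)⁺ = (e, 1). Then: (i) C is closed under this multiplication, the multiplication is associative, and (1, 1) is an identity element; (ii) C is a left restriction monoid, with projections P(C) = {(e, 1) : e ∈ P}; (iii) C is proper, i.e. for all x, y ∈ C: x = y if and only if x⁺ = y⁺ and gx = gy for some g ∈ P(C); (iv) the map ψ : C → M, (e, s) ↦ es, is a surjective monoid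 homomorphism satisfying ψ(x⁺) = ψ(x)⁺ for all x ∈ C, and the restriction of ψ to P(C) is injective (ψ is projection-separating). -/
/-- The multiplication `(e, s)(f, t) = (e·(sf)⁺, st)` on the cover `C`. -/
def coverMul {M : Type*} [Monoid M] (plus : M → M) (p q : M × M) : M × M :=
  (p.1 * plus (p.2 * q.1), p.2 * q.2)

/-- The unary operation `(e, s)⁺ = (e, 1)` on the cover `C`. -/
def coverPlus {M : Type*} [Monoid M] (p : M × M) : M × M :=
  (p.1, 1)

/-- The carrier `C = {(e, s) ∈ P × M : e = e·s⁺}` of the proper cover. -/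
def coverSet {M : Type*} [Monoid M] (plus : M → M) : Set (M × M) :=
  {p | p.1 ∈ Set.range plus ∧ p.1 = p.1 * plus p.2}

/-- Every left restriction monoid `M` has a proper cover:
with `C = {(e, s) ∈ P × M : e = e·s⁺}`, `(e, s)(f, t) = (e·(sf)⁺, st)` and
`(e, s)⁺ = (e, 1)`:
(i) `C` is closed under the multiplication, which is associative on `C`, with identity
`(1, 1)`;
(ii) `C` is a left restriction monoid whose projections are `P(C) = {(e, 1) : e ∈ P}`;
(iii) `C` is proper: `x = y ↔ (x⁺ = y⁺ ∧ ∃ g ∈ P(C), gx = gy)` for `x, y ∈ C`;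
(iv) `ψ : C → M, (e, s) ↦ es` is a surjective homomorphism with `ψ(x⁺) = ψ(x)⁺`, injective
on `P(C)`. -/
theorem stmt_11 {M : Type*} [Monoid M] (plus : M → M)
    (L1 : ∀ x, plus x * x = x)
    (L2 : ∀ x y, plus x * plus y = plus y * plus x)
    (L3 : ∀ x y, plus (plus x * y) = plus x * plus y)
    (L4 : ∀ x y, x * plus y = plus (x * y) * x) :
    -- (i) : C is a monoid under `coverMul` with identity (1, 1)
    (∀ p ∈ coverSet plus, ∀ q ∈ coverSet plus, coverMul plus p q ∈ coverSet plus) ∧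
    (∀ p ∈ coverSet plus, ∀ q ∈ coverSet plus, ∀ r ∈ coverSet plus,
      coverMul plus (coverMul plus p q) r = coverMul plus p (coverMul plus q r)) ∧
    ((1, 1) ∈ coverSet plus ∧ ∀ p ∈ coverSet plus,
      coverMul plus (1, 1) p = p ∧ coverMul plus p (1, 1) = p) ∧
    -- (ii) : C is left restriction with projections {(e, 1) : e ∈ P}
    (∀ p ∈ coverSet plus, coverPlus p ∈ coverSet plus) ∧
    (∀ p ∈ coverSet plus, coverMul plus (coverPlus p) p = p) ∧
    (∀ p ∈ coverSet plus, ∀ q ∈ coverSet plus,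
      coverMul plus (coverPlus p) (coverPlus q) = coverMul plus (coverPlus q) (coverPlus p)) ∧
    (∀ p ∈ coverSet plus, ∀ q ∈ coverSet plus,
      coverPlus (coverMul plus (coverPlus p) q) = coverMul plus (coverPlus p) (coverPlus q)) ∧
    (∀ p ∈ coverSet plus, ∀ q ∈ coverSet plus,
      coverMul plus p (coverPlus q) = coverMul plus (coverPlus (coverMul plus p q)) p) ∧
    (coverPlus '' coverSet plus = {p : M × M | p.1 ∈ Set.range plus ∧ p.2 = 1}) ∧
    -- (iii) : C is proper
    (∀ p ∈ coverSet plus, ∀ q ∈ coverSet plus,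
      (p = q ↔ (coverPlus p = coverPlus q ∧
        ∃ g ∈ coverPlus '' coverSet plus, coverMul plus g p = coverMul plus g q))) ∧
    -- (iv) : ψ(e, s) = es is a projection-separating surjective covering morphism
    (∀ m : M, ∃ p ∈ coverSet plus, p.1 * p.2 = m) ∧
    (∀ p ∈ coverSet plus, ∀ q ∈ coverSet plus,
      (coverMul plus p q).1 * (coverMul plus p q).2 = (p.1 * p.2) * (q.1 * q.2)) ∧
    (∀ p ∈ coverSet plus, (coverPlus p).1 * (coverPlus p).2 = plus (p.1 * p.2)) ∧
    (∀ p ∈ coverPlus '' coverSet plus, ∀ q ∈ coverPlus '' coverSet plus,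
      p.1 * p.2 = q.1 * q.2 → p = q) := by
  have plus_one : plus 1 = 1 := by simpa using L1 1
  have plus_plus (x : M) : plus (plus x) = plus x := by simpa [plus_one] using L3 x 1
  have plus_idem (x : M) : plus x * plus x = plus x := by rw [← L3, L1]
  have plus_mul_absorb (x y : M) : plus x * plus (x * y) = plus (x * y) := by
    rw [← L3, ← mul_assoc, L1]
  have plus_mul_plus (x y : M) : plus (x * plus y) = plus (x * y) := by
    rw [L4, L3, L2, plus_mul_absorb]
  have image_eq : coverPlus '' coverSet plus =
      {p : M × M | p.1 ∈ Set.range plus ∧ p.2 = 1} := by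
    ext ⟨e, s⟩
    constructor
    · rintro ⟨p, hp, h⟩
      obtain ⟨rfl, rfl⟩ := Prod.mk.inj h
      exact ⟨hp.1, rfl⟩
    · rintro ⟨he, hs⟩
      obtain rfl : s = 1 := hs
      exact ⟨(e, 1), ⟨he, by simp [plus_one]⟩, rfl⟩
  refine ⟨?_, ?_, ⟨⟨⟨1, plus_one⟩, by simp [plus_one]⟩, ?_⟩, ?_, ?_, ?_, ?_, ?_, image_eq,
    ?_, ?_, ?_, ?_, ?_⟩
  · rintro ⟨_, s⟩ ⟨⟨a, rfl⟩, -⟩ ⟨_, t⟩ ⟨⟨b, rfl⟩, hq⟩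
    dsimp only at hq
    refine ⟨⟨plus a * (s * plus b), L3 _ _⟩, ?_⟩
    have h : plus (s * plus b) = plus (s * plus b) * plus (s * t) := by
      conv_lhs => rw [hq, L2 b t, ← mul_assoc, L4 s t, mul_assoc, L3, L2]
    simp only [coverMul]
    rw [mul_assoc, ← h]
  · rintro ⟨_, s⟩ ⟨⟨a, rfl⟩, -⟩ ⟨_, t⟩ ⟨⟨b, rfl⟩, -⟩ ⟨g, u⟩ -
    simp only [coverMul, mul_assoc, Prod.mk.injEq, and_true]
    congr 1
    rw [plus_mul_plus s b, ← mul_assoc s (plus b), L4 s b, mul_assoc, L3, plus_mul_plus]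
  · rintro ⟨_, s⟩ ⟨⟨a, rfl⟩, hp⟩
    dsimp only at hp
    simp [coverMul, plus_plus, ← hp]
  · rintro ⟨e, s⟩ ⟨he, -⟩
    exact ⟨he, by simp [coverPlus, plus_one]⟩
  · rintro ⟨_, s⟩ ⟨⟨a, rfl⟩, -⟩
    simp [coverMul, coverPlus, plus_plus, plus_idem]
  · rintro ⟨_, s⟩ ⟨⟨a, rfl⟩, -⟩ ⟨_, t⟩ ⟨⟨b, rfl⟩, -⟩
    simp [coverMul, coverPlus, plus_plus, L2 a b]
  · rintro p - q -
    simp [coverMul, coverPlus]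
  · rintro ⟨_, s⟩ ⟨⟨a, rfl⟩, -⟩ ⟨f, t⟩ -
    simp only [coverMul, coverPlus, one_mul, mul_one, Prod.mk.injEq, and_true]
    rw [plus_plus, mul_assoc, L2 _ a, ← mul_assoc, plus_idem]
  · rintro ⟨e, s⟩ hp ⟨f, t⟩ -
    constructor
    · intro h
      exact ⟨by rw [h], coverPlus (e, s), ⟨_, hp, rfl⟩, by rw [h]⟩
    · rintro ⟨h, _, ⟨g, -, rfl⟩, hg⟩
      have hst := congrArg Prod.snd hg
      simp only [coverMul, coverPlus, one_mul] at hst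
      exact Prod.ext (Prod.mk.inj h).1 hst
  · intro m
    exact ⟨(plus m, m), ⟨⟨m, rfl⟩, (plus_idem m).symm⟩, L1 m⟩
  · rintro ⟨e, s⟩ - ⟨_, t⟩ ⟨⟨b, rfl⟩, -⟩
    simp only [coverMul]
    rw [plus_mul_plus, mul_assoc e, ← mul_assoc _ s t, ← L4]
    simp only [mul_assoc]
  · rintro ⟨_, s⟩ ⟨⟨a, rfl⟩, hp⟩
    simpa [coverPlus, L3] using hp
  · rintro _ ⟨p, -, rfl⟩ _ ⟨q, -, rfl⟩ h
    simpa [coverPlus] using h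
end

section
/- Let S be a proper left restriction monoid with semilattice of projections P = {s⁺ : s ∈ S}, and let σ = {(s, t) ∈ S × S : es = et for some e ∈ P}, which is a monoid congruence on S (the least congruence identifying all projections); properness means that for all s, t ∈ S: s = t if and only if s⁺ = t⁺ and (s, t) ∈ σ. Then there exist: a monoid semilattice Q (a commutative monoid all of whose elements are idempotent); a left action of the quotient monoid S/σ on Q which is monoidal and by monoid morphisms (x•(qr) = (x•q)(x•r), x•1 = 1, (xy)•q = x•(y•q), 1•q = q); an injective semigroup homomorphism ψ from S into the semidirect product Q ⋊ (S/σ) (the monoid on Q × (S/σ) with (q, x)(r, y) = (q(x•r), xy)); and a subsemigroup Q′ of Q isomorphic to P such that ψ restricted to P is an isomorphism from P onto Q′ × {[1]}, where [1] is the σ-class of 1. In particular, S embeds into a semidirect product of a semilattice containing (a copy of) P by S/σ. -/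
universe u

/-- The laws of a left restriction monoid for a unary operation `plus`. -/
structure IsLeftRestriction {S : Type u} [Monoid S] (plus : S → S) : Prop where
  plus_mul_self : ∀ x, plus x * x = x
  plus_comm : ∀ x y, plus x * plus y = plus y * plus x
  plus_plus_mul : ∀ x y, plus (plus x * y) = plus x * plus y
  mul_plus : ∀ x y, x * plus y = plus (x * y) * x

/-- The relation `σ`: two elements agree after left multiplication by some projection. -/
def projRel {S : Type u} [Monoid S] (plus : S → S) (s t : S) : Prop :=
  ∃ e ∈ Set.range plus, e * s = e * t

/-- Properness: an element is determined by its projection and its `σ`-class. -/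
def IsProperPlus {S : Type u} [Monoid S] (plus : S → S) : Prop :=
  ∀ s t : S, s = t ↔ (plus s = plus t ∧ projRel plus s t)

namespace IsLeftRestriction

variable {S : Type u} [Monoid S] {plus : S → S}

theorem plus_one (h : IsLeftRestriction plus) : plus 1 = 1 := by
  simpa using h.plus_mul_self 1

theorem plus_plus (h : IsLeftRestriction plus) (x : S) : plus (plus x) = plus x := by
  simpa [h.plus_one] using h.plus_plus_mul x 1

theorem plus_mul_plus_self (h : IsLeftRestriction plus) (x : S) :
    plus x * plus x = plus x := by
  rw [← h.plus_plus_mul, h.plus_mul_self]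

theorem plus_mul_mul_plus (h : IsLeftRestriction plus) (x y : S) :
    plus (x * y) * plus x = plus (x * y) := by
  rw [h.plus_comm, ← h.plus_plus_mul, ← mul_assoc, h.plus_mul_self]

theorem plus_mul_plus (h : IsLeftRestriction plus) (x y : S) :
    plus (x * plus y) = plus (x * y) := by
  rw [h.mul_plus, h.plus_plus_mul, h.plus_mul_mul_plus]

/-- The relation `σ` as a congruence. -/
def projCon (h : IsLeftRestriction plus) : Con S where
  r := projRel plus
  iseqv :=
    { refl := fun _ => ⟨plus 1, ⟨1, rfl⟩, rfl⟩
      symm := fun ⟨e, he, hst⟩ => ⟨e, he, hst.symm⟩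
      trans := by
        rintro s t w ⟨_, ⟨a, rfl⟩, hst⟩ ⟨_, ⟨b, rfl⟩, htw⟩
        refine ⟨plus a * plus b, ⟨plus a * b, h.plus_plus_mul a b⟩, ?_⟩
        rw [h.plus_comm, mul_assoc, hst, ← mul_assoc, h.plus_comm, mul_assoc, htw,
          mul_assoc] }
  mul' := by
    rintro s t a b ⟨_, ⟨p, rfl⟩, hst⟩ ⟨_, ⟨q, rfl⟩, hab⟩
    refine ⟨plus p * plus (t * q), ⟨plus p * (t * q), h.plus_plus_mul p _⟩, ?_⟩
    have left : plus p * plus (t * q) * (s * a) = plus p * plus (t * q) * (t * a) := by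
      rw [h.plus_comm, mul_assoc, mul_assoc, ← mul_assoc (plus p) s, hst, mul_assoc]
    have right : plus (t * q) * (t * a) = plus (t * q) * (t * b) := by
      rw [← mul_assoc, ← h.mul_plus, mul_assoc, hab, ← mul_assoc, h.mul_plus, mul_assoc]
    rw [left, mul_assoc, right, mul_assoc]

theorem conGen_projRel_iff (h : IsLeftRestriction plus) {s t : S} :
    conGen (projRel plus) s t ↔ projRel plus s t :=
  ⟨fun hst => (Con.conGen_le.2 (fun _ _ hab => hab) : conGen (projRel plus) ≤ h.projCon) hst,
    fun hst => ConGen.Rel.of _ _ hst⟩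

theorem mk_eq_mk_iff (h : IsLeftRestriction plus) {s t : S} :
    (s : (conGen (projRel plus)).Quotient) = t ↔ projRel plus s t :=
  (Con.eq _).trans h.conGen_projRel_iff

theorem mk_plus (h : IsLeftRestriction plus) (s : S) :
    ((plus s : S) : (conGen (projRel plus)).Quotient) = 1 :=
  h.mk_eq_mk_iff.2 ⟨plus s, ⟨s, rfl⟩, by rw [h.plus_mul_plus_self, mul_one]⟩

theorem eq_of_plus_eq (h : IsLeftRestriction plus) (hp : IsProperPlus plus) {s t : S}
    (hplus : plus s = plus t) (hst : (s : (conGen (projRel plus)).Quotient) = t) : s = t :=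
  (hp s t).2 ⟨hplus, h.mk_eq_mk_iff.1 hst⟩

theorem plus_eq_self_of_mk_eq_one (h : IsLeftRestriction plus) (hp : IsProperPlus plus) {s : S}
    (hs : (s : (conGen (projRel plus)).Quotient) = 1) : plus s = s :=
  h.eq_of_plus_eq hp (h.plus_plus s) ((h.mk_plus s).trans hs.symm)

end IsLeftRestriction

/-- At a class `y`, the projections of the elements of `y` that are fixed by right
multiplication by `e`. -/
def fixedProj {S : Type u} [Monoid S] (plus : S → S) (e : S)
    (y : (conGen (projRel plus)).Quotient) : Set S :=
  {p | ∃ v : S, (v : (conGen (projRel plus)).Quotient) = y ∧ v * e = v ∧ plus v = p}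

namespace IsLeftRestriction

variable {S : Type u} [Monoid S] {plus : S → S}

theorem mem_fixedProj_one (h : IsLeftRestriction plus) (hp : IsProperPlus plus) {e p : S} :
    p ∈ fixedProj plus e 1 ↔ plus p = p ∧ p * e = p := by
  constructor
  · rintro ⟨v, hv, hve, rfl⟩
    rw [h.plus_eq_self_of_mk_eq_one hp hv]
    exact ⟨h.plus_eq_self_of_mk_eq_one hp hv, hve⟩
  · rintro ⟨hpp, hpe⟩
    exact ⟨p, by rw [← hpp, h.mk_plus], hpe, hpp⟩

theorem plus_eq_of_fixedProj_eq (h : IsLeftRestriction plus) (hp : IsProperPlus plus) {s t : S}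
    (hst : fixedProj plus (plus s) = fixedProj plus (plus t)) : plus s = plus t := by
  have le (a b : S) (hab : fixedProj plus (plus a) = fixedProj plus (plus b)) :
      plus a * plus b = plus a := by
    have ha := (h.mem_fixedProj_one hp (e := plus a)).2 ⟨h.plus_plus a, h.plus_mul_plus_self a⟩
    rw [hab] at ha
    exact ((h.mem_fixedProj_one hp).1 ha).2
  rw [← le s t hst, h.plus_comm, le t s hst.symm]

/-- The multiplication rule of the semidirect product, on first coordinates. -/
theorem fixedProj_plus_mul (h : IsLeftRestriction plus) (hp : IsProperPlus plus) (s t : S)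
    (y : (conGen (projRel plus)).Quotient) :
    fixedProj plus (plus (s * t)) y =
      fixedProj plus (plus s) y ∩ fixedProj plus (plus t) (y * s) := by
  ext p
  constructor
  · rintro ⟨v, rfl, hv, rfl⟩
    refine ⟨⟨v, rfl, ?_, rfl⟩, v * s * plus t, ?_, ?_, ?_⟩
    · rw [← hv, mul_assoc, h.plus_mul_mul_plus]
    · rw [Con.coe_mul, Con.coe_mul, h.mk_plus, mul_one]
    · rw [mul_assoc, h.plus_mul_plus_self]
    · rw [h.plus_mul_plus, mul_assoc, ← h.plus_mul_plus, hv]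
  · rintro ⟨⟨v, rfl, hv, rfl⟩, w, hw, hwt, hwv⟩
    have hvs : plus (v * s) = plus v := by rw [← h.plus_mul_plus, hv]
    obtain rfl : w = v * s :=
      h.eq_of_plus_eq hp (hwv.trans hvs.symm) (hw.trans (Con.coe_mul _ _).symm)
    refine ⟨v, rfl, ?_, rfl⟩
    rw [h.mul_plus, ← mul_assoc, ← h.plus_mul_plus, hwt, hvs, h.plus_mul_self]

end IsLeftRestriction

/-- Let `S` be a proper left restriction monoid with projections
`P = {s⁺ : s ∈ S}` and least congruence `σ = {(s, t) : es = et for some e ∈ P}` identifying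
all projections. Then there exist a monoid semilattice `Q`, a monoidal left action of `S/σ`
on `Q` by monoid morphisms, an injective semigroup homomorphism `ψ` of `S` into the
semidirect product `Q ⋊ (S/σ)`, and a subsemigroup `Q′` of `Q` such that `ψ` restricted to
`P` is an isomorphism onto `Q′ × {[1]}`. -/
theorem stmt_12 {S : Type u} [Monoid S] (plus : S → S)
    (L1 : ∀ x, plus x * x = x)
    (L2 : ∀ x y, plus x * plus y = plus y * plus x)
    (L3 : ∀ x y, plus (plus x * y) = plus x * plus y)
    (L4 : ∀ x y, x * plus y = plus (x * y) * x)
    (hproper : ∀ s t : S,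
      s = t ↔ (plus s = plus t ∧ ∃ e ∈ Set.range plus, e * s = e * t)) :
    ∃ (Q : Type u) (_ : CommMonoid Q)
      (act : (conGen fun s t : S => ∃ e ∈ Set.range plus, e * s = e * t).Quotient → Q → Q),
      (∀ q : Q, q * q = q) ∧
      (∀ x y q, act (x * y) q = act x (act y q)) ∧
      (∀ q, act 1 q = q) ∧
      (∀ x q r, act x (q * r) = act x q * act x r) ∧
      (∀ x, act x 1 = 1) ∧
      ∃ ψ : S → Q × (conGen fun s t : S => ∃ e ∈ Set.range plus, e * s = e * t).Quotient,
        Function.Injective ψ ∧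
        (∀ s t : S, ψ (s * t) = ((ψ s).1 * act (ψ s).2 (ψ t).1, (ψ s).2 * (ψ t).2)) ∧
        ∃ Q' : Set Q,
          (∀ a ∈ Q', ∀ b ∈ Q', a * b ∈ Q') ∧
          (∀ e ∈ Set.range plus, (ψ e).1 ∈ Q' ∧ (ψ e).2 = 1) ∧
          (∀ q ∈ Q', ∃ e ∈ Set.range plus, (ψ e).1 = q) := by
  have h : IsLeftRestriction plus := ⟨L1, L2, L3, L4⟩
  have hp : IsProperPlus plus := hproper
  change ∃ (Q : Type u) (_ : CommMonoid Q) (act : (conGen (projRel plus)).Quotient → Q → Q), _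
  let Q := (conGen (projRel plus)).Quotient → Set S
  let inst : CommMonoid Q :=
    { mul := fun f g y => f y ∩ g y
      one := fun _ => Set.univ
      mul_assoc := fun _ _ _ => funext fun _ => Set.inter_assoc _ _ _
      one_mul := fun _ => funext fun _ => Set.univ_inter _
      mul_one := fun _ => funext fun _ => Set.inter_univ _
      mul_comm := fun _ _ => funext fun _ => Set.inter_comm _ _ }
  have hmul (s t : S) : fixedProj plus (plus (s * t)) =
      inst.mul (fixedProj plus (plus s)) fun y => fixedProj plus (plus t) (y * s) :=
    funext (h.fixedProj_plus_mul hp s t)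
  refine ⟨Q, inst, fun x f y => f (y * x), fun f => funext fun _ => Set.inter_self _,
    fun x y f => funext fun z => congrArg f (mul_assoc z x y).symm,
    fun f => funext fun z => congrArg f (mul_one z), fun _ _ _ => rfl, fun _ => rfl,
    fun s => (fixedProj plus (plus s), (s : (conGen (projRel plus)).Quotient)), ?_, ?_,
    Set.range fun s => fixedProj plus (plus s), ?_, ?_, ?_⟩
  · intro s t hst
    exact h.eq_of_plus_eq hp (h.plus_eq_of_fixedProj_eq hp (congrArg Prod.fst hst))
      (congrArg Prod.snd hst)
  · exact fun s t => Prod.ext (hmul s t) rfl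
  · rintro _ ⟨s, rfl⟩ _ ⟨t, rfl⟩
    refine ⟨plus s * t, (hmul (plus s) t).trans ?_⟩
    simp only [h.plus_plus, h.mk_plus, mul_one]
    rfl
  · rintro _ ⟨s, rfl⟩
    exact ⟨⟨plus s, rfl⟩, h.mk_plus s⟩
  · rintro _ ⟨s, rfl⟩
    exact ⟨plus s, ⟨s, rfl⟩, by simp only [h.plus_plus]⟩
end

section
/- Let M be a monoid, and let U and S be submonoids of M such that M = US (every element of M equals us for some u ∈ U, s ∈ S) and such that (U, S) is an action pair: there is a left action (s, u) ↦ s•u of S on U by semigroup morphisms with (A1) su = (s•u)s for all s ∈ S, u ∈ U, and (A2) us = vt ⟹ us⁺ = vt⁺ for all u, v ∈ U, s, t ∈ S, where s⁺ = s•1. Let P be the subsemigroup of U generated by {s⁺ : s ∈ S}, and let σ be the congruence on S generated by κ = {(s, t) ∈ S × S : ps = qt for some p, q ∈ P}. Assume (U, S) is proper: for all u, v ∈ U and s, t ∈ S, us = vt if and only if (us⁺ = vt⁺ and (s, t) ∈ σ). Then there exist: a monoid 𝒰; a left action of S/σ on 𝒰 which is monoidal and by monoid morphisms; an injective semigroup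 homomorphism ψ from M into the semidirect product 𝒰 ⋊ (S/σ) (the monoid on 𝒰 × (S/σ) with (q, x)(r, y) = (q(x•r), xy)); and a subsemigroup U′ of 𝒰 isomorphic to U such that ψ restricted to U is an isomorphism from U onto U′ × {[1]}, where [1] denotes the σ-class of 1. -/
universe u

/-- The relation `κ = {(s, t) : ps = qt for some p, q ∈ P}` on `S`, where `P = ⟨s⁺ : s ∈ S⟩`
is the subsemigroup generated by the elements `s⁺ = s•1`. -/
def pairKappa {M : Type u} [Monoid M] (U S : Submonoid M) (act : S → U → U) :
    S → S → Prop := fun s t =>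
  ∃ p ∈ Subsemigroup.closure {x : M | ∃ s' : S, ((act s' 1 : U) : M) = x},
    ∃ q ∈ Subsemigroup.closure {x : M | ∃ s' : S, ((act s' 1 : U) : M) = x},
      p * (s : M) = q * (t : M)

section EvalMap

variable {U S : Type u} [Monoid U] [Monoid S] {c : Con S} {act : S → U → U}

/-- The evaluation at `x : S/σ` of the letter `w : U`, acting on sets of elements of `U`: an
element `v` is sent to `v(s•w)` for each `s` in the class `x` with `vs⁺ = v`. -/
def evalMap (c : Con S) (act : S → U → U) (x : c.Quotient) (w : U) (A : Set U) : Set U :=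
  {z | ∃ v ∈ A, ∃ s : S, (s : c.Quotient) = x ∧ v * act s 1 = v ∧ z = v * act s w}

/-- The map from `U` to the monoid of functions on `S/σ` that sends `w` to `x ↦ evalMap x w`;
maps on sets are composed from left to right. -/
def evalFun (c : Con S) (act : S → U → U) (w : U) : c.Quotient → (Function.End (Set U))ᵐᵒᵖ :=
  fun x => MulOpposite.op (evalMap c act x w)

theorem evalMap_evalMap_self (hhom : ∀ s u v, act s (u * v) = act s u * act s v)
    (hindep : ∀ (v w : U) (s t : S), v * act s 1 = v → v * act t 1 = v →
      (s : c.Quotient) = t → v * act s w = v * act t w)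
    (x : c.Quotient) (u v : U) (A : Set U) :
    evalMap c act x v (evalMap c act x u A) = evalMap c act x (u * v) A := by
  have hfix : ∀ a s, a * act s u * act s 1 = a * act s u := fun a s => by
    rw [mul_assoc, ← hhom, mul_one]
  ext z
  constructor
  · rintro ⟨_, ⟨a, ha, s, hs, has, rfl⟩, t, ht, hat, rfl⟩
    refine ⟨a, ha, s, hs, has, ?_⟩
    rw [hindep _ v t s hat (hfix a s) (ht.trans hs.symm), hhom, mul_assoc]
  · rintro ⟨a, ha, s, hs, has, rfl⟩
    exact ⟨_, ⟨a, ha, s, hs, has, rfl⟩, s, hs, hfix a s, by rw [hhom, mul_assoc]⟩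

theorem evalMap_evalMap_plus (hcomp : ∀ s t u, act (s * t) u = act s (act t u))
    (hhom : ∀ s u v, act s (u * v) = act s u * act s v)
    (hindep : ∀ (v w : U) (s t : S), v * act s 1 = v → v * act t 1 = v →
      (s : c.Quotient) = t → v * act s w = v * act t w)
    (x : c.Quotient) (s : S) (w : U) (A : Set U) :
    evalMap c act (x * s) w (evalMap c act x (act s 1) A) = evalMap c act x (act s w) A := by
  have hfix : ∀ a t, a * act t (act s 1) * act (t * s) 1 = a * act t (act s 1) := fun a t => by
    rw [mul_assoc, hcomp, ← hhom, ← hhom, mul_one]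
  have hmul : ∀ a t, a * act t (act s 1) * act (t * s) w = a * act t (act s w) := fun a t => by
    rw [mul_assoc, hcomp, ← hhom, ← hhom, one_mul]
  ext z
  constructor
  · rintro ⟨_, ⟨a, ha, t, ht, hat, rfl⟩, r, hr, har, rfl⟩
    refine ⟨a, ha, t, ht, hat, ?_⟩
    rw [hindep _ w r (t * s) har (hfix a t) (by rw [hr, ← ht, Con.coe_mul]), hmul]
  · rintro ⟨a, ha, t, ht, hat, rfl⟩
    exact ⟨_, ⟨a, ha, t, ht, hat, rfl⟩, t * s, by rw [← ht, Con.coe_mul], hfix a t,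
      (hmul a t).symm⟩

theorem evalFun_injective (hone : ∀ u, act 1 u = u)
    (hindep : ∀ (v w : U) (s t : S), v * act s 1 = v → v * act t 1 = v →
      (s : c.Quotient) = t → v * act s w = v * act t w) :
    Function.Injective (evalFun c act) := by
  intro u v h
  have h₁ : evalMap c act 1 u {1} = evalMap c act 1 v {1} :=
    congrFun (MulOpposite.op_injective (congrFun h 1)) {1}
  have hu : u ∈ evalMap c act 1 u {1} :=
    ⟨1, rfl, 1, Con.coe_one, by rw [hone, one_mul], by rw [hone, one_mul]⟩
  rw [h₁] at hu
  obtain ⟨_, rfl, s, hs, hs₁, rfl⟩ := hu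
  rw [hindep 1 v s 1 hs₁ (by rw [hone, one_mul]) (hs.trans Con.coe_one.symm), hone, one_mul]

end EvalMap

/-- Let `M = US` be a `(U, S)`-proper monoid: `U, S` are submonoids,
`(U, S)` is an action pair (with action `act`, (A1) and (A2)), `M = US`, `P = ⟨s⁺ : s ∈ S⟩`,
`σ` is the congruence on `S` generated by `κ = {(s,t) : ps = qt for some p, q ∈ P}`, and
`us = vt ↔ (us⁺ = vt⁺ ∧ (s, t) ∈ σ)` for all `u, v ∈ U`, `s, t ∈ S`. Then there exist a
monoid `Q`, a monoidal left action of `S/σ` on `Q` by monoid morphisms, an injective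
semigroup homomorphism `ψ : M → Q ⋊ (S/σ)`, and a subsemigroup `Q′ ⊆ Q` such that `ψ`
restricted to `U` is an isomorphism from `U` onto `Q′ × {[1]}`. -/
theorem stmt_13 {M : Type u} [Monoid M] (U S : Submonoid M) (act : S → U → U)
    (hcomp : ∀ (s t : S) (u : U), act (s * t) u = act s (act t u))
    (hhom : ∀ (s : S) (u v : U), act s (u * v) = act s u * act s v)
    (hA1 : ∀ (s : S) (u : U), (s : M) * (u : M) = ((act s u : U) : M) * (s : M))
    (hA2 : ∀ (u v : U) (s t : S), (u : M) * (s : M) = (v : M) * (t : M) →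
      (u : M) * ((act s 1 : U) : M) = (v : M) * ((act t 1 : U) : M))
    (hUS : ∀ m : M, ∃ (u : U) (s : S), m = (u : M) * (s : M))
    (hproper : ∀ (u v : U) (s t : S),
      (u : M) * (s : M) = (v : M) * (t : M) ↔
        ((u : M) * ((act s 1 : U) : M) = (v : M) * ((act t 1 : U) : M) ∧
          conGen (pairKappa U S act) s t)) :
    ∃ (Q : Type u) (_ : Monoid Q)
      (act' : (conGen (pairKappa U S act)).Quotient → Q → Q),
      (∀ x y q, act' (x * y) q = act' x (act' y q)) ∧
      (∀ q, act' 1 q = q) ∧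
      (∀ x q r, act' x (q * r) = act' x q * act' x r) ∧
      (∀ x, act' x 1 = 1) ∧
      ∃ ψ : M → Q × (conGen (pairKappa U S act)).Quotient,
        Function.Injective ψ ∧
        (∀ a b : M, ψ (a * b) = ((ψ a).1 * act' (ψ a).2 (ψ b).1, (ψ a).2 * (ψ b).2)) ∧
        ∃ Q' : Set Q,
          (∀ a ∈ Q', ∀ b ∈ Q', a * b ∈ Q') ∧
          (∀ u : U, (ψ (u : M)).1 ∈ Q' ∧ (ψ (u : M)).2 = 1) ∧
          (∀ q ∈ Q', ∃ u : U, (ψ (u : M)).1 = q) := by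
  have hone : ∀ u : U, act 1 u = u := fun u => Subtype.ext (by simpa using (hA1 1 u).symm)
  have hindep : ∀ (v w : U) (s t : S), v * act s 1 = v → v * act t 1 = v →
      (s : (conGen (pairKappa U S act)).Quotient) = t → v * act s w = v * act t w := by
    intro v w s t hs ht hst
    have hvst : (v : M) * s = v * t :=
      (hproper v v s t).2 ⟨by rw [← Submonoid.coe_mul, ← Submonoid.coe_mul, hs, ht],
        (Con.eq _).1 hst⟩
    have h := hA2 (v * act s w) (v * act t w) s t (by
      rw [Submonoid.coe_mul, Submonoid.coe_mul, mul_assoc, mul_assoc, ← hA1, ← hA1, ← mul_assoc,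
        ← mul_assoc, hvst])
    have h' : v * act s w * act s 1 = v * act t w * act t 1 := Subtype.ext h
    rwa [mul_assoc, mul_assoc, ← hhom, ← hhom, mul_one] at h'
  have hself : ∀ u v : U, evalFun (conGen (pairKappa U S act)) act (u * v) =
      evalFun _ act u * evalFun _ act v := fun u v => funext fun x =>
    congrArg MulOpposite.op (funext fun A => (evalMap_evalMap_self hhom hindep x u v A).symm)
  have hplus : ∀ (s : S) (w : U), (evalFun (conGen (pairKappa U S act)) act (act s 1) *
      fun x => evalFun _ act w (x * s)) = evalFun _ act (act s w) := fun s w => funext fun x =>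
    congrArg MulOpposite.op (funext fun A => evalMap_evalMap_plus hcomp hhom hindep x s w A)
  choose fu fs hfus using hUS
  let ψ : M → ((conGen (pairKappa U S act)).Quotient → (Function.End (Set U))ᵐᵒᵖ) ×
      (conGen (pairKappa U S act)).Quotient :=
    fun m => (evalFun _ act (fu m * act (fs m) 1), (fs m : (conGen (pairKappa U S act)).Quotient))
  have hψ : ∀ (u : U) (s : S), ψ (u * s) =
      (evalFun _ act (u * act s 1), (s : (conGen (pairKappa U S act)).Quotient)) := by
    intro u s
    obtain ⟨h₁, h₂⟩ := (hproper _ _ _ _).1 (hfus (u * s)).symm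
    have h₁' : fu (u * s) * act (fs (u * s)) 1 = u * act s 1 := Subtype.ext h₁
    exact Prod.ext (congrArg (evalFun _ act) h₁') ((Con.eq _).2 h₂)
  have hψU : ∀ u : U, ψ u = (evalFun _ act u, 1) := fun u => by
    have h := hψ u 1
    rwa [Submonoid.coe_one, mul_one, hone, mul_one] at h
  refine ⟨(conGen (pairKappa U S act)).Quotient → (Function.End (Set U))ᵐᵒᵖ, inferInstance,
    fun x f y => f (y * x), fun x y q => funext fun z => congrArg q (mul_assoc z x y).symm,
    fun q => funext fun z => congrArg q (mul_one z), fun _ _ _ => rfl, fun _ => rfl, ψ, ?_, ?_,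
    Set.range (evalFun _ act), ?_, ?_, ?_⟩
  · intro a b h
    rw [hfus a, hfus b]
    obtain ⟨h₁, h₂⟩ := Prod.ext_iff.1 h
    exact (hproper _ _ _ _).2
      ⟨congrArg Subtype.val (evalFun_injective hone hindep h₁), (Con.eq _).1 h₂⟩
  · intro a b
    obtain ⟨u, s, rfl⟩ : ∃ (u : U) (s : S), a = u * s := ⟨_, _, hfus a⟩
    obtain ⟨v, t, rfl⟩ : ∃ (v : U) (t : S), b = v * t := ⟨_, _, hfus b⟩
    have hmul : (u * s * (v * t) : M) = (u * act s v : U) * (s * t : S) := by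
      rw [Submonoid.coe_mul, Submonoid.coe_mul, mul_assoc, ← mul_assoc (s : M), hA1]
      simp only [mul_assoc]
    rw [hmul, hψ, hψ, hψ]
    refine Prod.ext ?_ (Con.coe_mul _ _)
    dsimp only
    rw [mul_assoc, hcomp, ← hhom, hself u, hself u, mul_assoc, hplus]
  · rintro _ ⟨u, rfl⟩ _ ⟨v, rfl⟩
    exact ⟨u * v, hself u v⟩
  · exact fun u => by rw [hψU]; exact ⟨⟨u, rfl⟩, rfl⟩
  · rintro _ ⟨u, rfl⟩
    exact ⟨u, by rw [hψU]⟩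
end

section
/- Let U and S be monoids, and let S act monoidally on U on the left by semigroup morphisms (1•u = u, (st)•u = s•(t•u), s•(uv) = (s•u)(s•v)); write s⁺ = s•1. Suppose U has monoid presentation Mon⟨X_U | R_U⟩ via a surjective homomorphism φ_U : X_U* → U whose kernel is the congruence generated by R_U, and similarly S has presentation Mon⟨X_S | R_S⟩ via φ_S : X_S* → S, where X_U and X_S are disjoint, no generator is sent to the identity, φ_U and φ_S are injective on letters, and there are normal form functions N_U : U → X_U* and N_S : S → X_S* (φ_U(N_U(u)) = u, φ_S(N_S(s)) = s) with N_U(1) = ε = N_S(1). Write w̄ for the image of a letter w under φ_U or φ_S. Let M = {(u, s) ∈ U × S : u = u·s⁺}, a monoid under the semidirect multiplication (u, s)(v, t) = (u(s•v), st) with identity (1, 1). Define φ : (X_U ∪ X_S)* → M on letters by φ(x) = (x̄, 1) for x ∈ X_U and φ(y) = (ȳ⁺, ȳ) for y ∈ X_S. Then φ is surjective and its kernel equals the congruence generated by R_U ∪ R_S ∪ R₁ ∪ R₃, where R₁ = {(yx, N_U(ȳ•x̄)·y) : y ∈ X_S, x ∈ X_U} and R₃ = {(y, N_U(ȳ⁺)·y)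 : y ∈ X_S with ȳ⁺ ≠ 1}; that is, M has monoid presentation Mon⟨X_U ∪ X_S | R_U ∪ R_S ∪ R₁ ∪ R₃⟩ via φ. -/
/-- Evaluation of a word over an alphabet `α` in `U × S` under the semidirect
multiplication, extending the letter map `f` (the canonical homomorphic extension). -/
def sdEval {U S : Type*} [Monoid U] [Monoid S] (act : S → U → U) {α : Type*}
    (f : α → U × S) (w : FreeMonoid α) : U × S :=
  (FreeMonoid.toList w).foldr (fun x p => sdMul act (f x) p) (1, 1)

/-- The images of the letters: `x ↦ (x̄, 1)` for `x ∈ X_U` and `y ↦ (ȳ⁺, ȳ)` for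
`y ∈ X_S`. -/
def sdLetter {U S : Type*} [Monoid U] [Monoid S] (act : S → U → U) {XU XS : Type*}
    (φU : FreeMonoid XU →* U) (φS : FreeMonoid XS →* S) : XU ⊕ XS → U × S :=
  Sum.elim (fun x => (φU (FreeMonoid.of x), 1))
    (fun y => (act (φS (FreeMonoid.of y)) 1, φS (FreeMonoid.of y)))

theorem sdEval_mul {U S α : Type*} [Monoid U] [Monoid S] {act : S → U → U}
    (hone : ∀ u : U, act 1 u = u)
    (hcomp : ∀ (s t : S) (u : U), act (s * t) u = act s (act t u))
    (hhom : ∀ (s : S) (u v : U), act s (u * v) = act s u * act s v)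
    (f : α → U × S) (w v : FreeMonoid α) :
    sdEval act f (w * v) = sdMul act (sdEval act f w) (sdEval act f v) := by
  induction w using FreeMonoid.inductionOn' with
  | one => simp [sdEval, sdMul, hone]
  | of_mul x w ih =>
    have cons (z : FreeMonoid α) :
        sdEval act f (FreeMonoid.of x * z) = sdMul act (f x) (sdEval act f z) := rfl
    rw [mul_assoc, cons, cons, ih]
    simp [sdMul, hcomp, hhom, mul_assoc]

theorem sdEval_map_inl {U S XU XS : Type*} [Monoid U] [Monoid S] {act : S → U → U}
    (hone : ∀ u : U, act 1 u = u)
    (φU : FreeMonoid XU →* U) (φS : FreeMonoid XS →* S) (w : FreeMonoid XU) :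
    sdEval act (sdLetter act φU φS) (FreeMonoid.map Sum.inl w) = (φU w, 1) := by
  induction w using FreeMonoid.inductionOn' with
  | one => simp [sdEval]
  | of_mul x w ih =>
    have cons : sdEval act (sdLetter act φU φS) (FreeMonoid.map Sum.inl (FreeMonoid.of x * w)) =
        sdMul act (φU (FreeMonoid.of x), 1)
          (sdEval act (sdLetter act φU φS) (FreeMonoid.map Sum.inl w)) := rfl
    rw [cons, ih]
    simp [sdMul, hone]

theorem sdEval_map_inr {U S XU XS : Type*} [Monoid U] [Monoid S] {act : S → U → U}
    (hone : ∀ u : U, act 1 u = u)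
    (hcomp : ∀ (s t : S) (u : U), act (s * t) u = act s (act t u))
    (hhom : ∀ (s : S) (u v : U), act s (u * v) = act s u * act s v)
    (φU : FreeMonoid XU →* U) (φS : FreeMonoid XS →* S) (w : FreeMonoid XS) :
    sdEval act (sdLetter act φU φS) (FreeMonoid.map Sum.inr w) = (act (φS w) 1, φS w) := by
  induction w using FreeMonoid.inductionOn' with
  | one => simp [sdEval, hone]
  | of_mul y w ih =>
    have cons : sdEval act (sdLetter act φU φS) (FreeMonoid.map Sum.inr (FreeMonoid.of y * w)) =
        sdMul act (act (φS (FreeMonoid.of y)) 1, φS (FreeMonoid.of y))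
          (sdEval act (sdLetter act φU φS) (FreeMonoid.map Sum.inr w)) := rfl
    rw [cons, ih]
    simp [sdMul, hcomp, ← hhom]

/-- A relation that is respected by a homomorphism has its generated congruence contained in the
kernel of the homomorphism. -/
theorem MonoidHom.map_eq_of_conGen {M P : Type*} [Monoid M] [Monoid P] (f : M →* P)
    {r : M → M → Prop} (h : ∀ a b, r a b → f a = f b) {a b : M} (hab : conGen r a b) :
    f a = f b :=
  (Con.conGen_le (c := Con.ker f)).2 h hab

theorem mk'_conGen_eq {M : Type*} [Monoid M] {r : M → M → Prop} {a b : M} (h : r a b) :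
    (conGen r).mk' a = (conGen r).mk' b :=
  (Con.eq _).2 (ConGen.Rel.of _ _ h)

/-- A homomorphism that respects the relations of `U` and `S` and satisfies `R₁` and `R₃`
identifies any two words with the same semidirect evaluation. -/
theorem map_eq_of_sdEval_eq {U S XU XS Q : Type*} [Monoid U] [Monoid S] [Monoid Q]
    {act : S → U → U}
    (hone : ∀ u : U, act 1 u = u)
    (hhom : ∀ (s : S) (u v : U), act s (u * v) = act s u * act s v)
    {RU : FreeMonoid XU → FreeMonoid XU → Prop}
    {RS : FreeMonoid XS → FreeMonoid XS → Prop}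
    {φU : FreeMonoid XU →* U} {φS : FreeMonoid XS →* S}
    (hUker : ∀ w v, φU w = φU v → conGen RU w v)
    (hSker : ∀ w v, φS w = φS v → conGen RS w v)
    {NU : U → FreeMonoid XU} {NS : S → FreeMonoid XS}
    (hNU : ∀ u, φU (NU u) = u) (hNS : ∀ s, φS (NS s) = s)
    (hNU1 : NU 1 = 1) (hNS1 : NS 1 = 1)
    (π : FreeMonoid (XU ⊕ XS) →* Q)
    (hRU : ∀ w v, RU w v →
      π (FreeMonoid.map Sum.inl w) = π (FreeMonoid.map Sum.inl v))
    (hRS : ∀ w v, RS w v →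
      π (FreeMonoid.map Sum.inr w) = π (FreeMonoid.map Sum.inr v))
    (hcross : ∀ (y : XS) (x : XU),
      π (FreeMonoid.of (Sum.inr y)) * π (FreeMonoid.of (Sum.inl x)) =
        π (FreeMonoid.map Sum.inl
          (NU (act (φS (FreeMonoid.of y)) (φU (FreeMonoid.of x))))) *
          π (FreeMonoid.of (Sum.inr y)))
    (hplus : ∀ y : XS, act (φS (FreeMonoid.of y)) 1 ≠ 1 →
      π (FreeMonoid.of (Sum.inr y)) =
        π (FreeMonoid.map Sum.inl (NU (act (φS (FreeMonoid.of y)) 1))) *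
          π (FreeMonoid.of (Sum.inr y)))
    {w v : FreeMonoid (XU ⊕ XS)}
    (h : sdEval act (sdLetter act φU φS) w = sdEval act (sdLetter act φU φS) v) :
    π w = π v := by
  have hU {a b c : FreeMonoid XU} (habc : φU a * φU b = φU c) :
      π (FreeMonoid.map Sum.inl a) * π (FreeMonoid.map Sum.inl b) =
        π (FreeMonoid.map Sum.inl c) := by
    rw [← map_mul, ← map_mul]
    exact (π.comp (FreeMonoid.map Sum.inl)).map_eq_of_conGen hRU
      (hUker _ _ ((map_mul φU a b).trans habc))
  have hS {a b c : FreeMonoid XS} (habc : φS a * φS b = φS c) :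
      π (FreeMonoid.map Sum.inr a) * π (FreeMonoid.map Sum.inr b) =
        π (FreeMonoid.map Sum.inr c) := by
    rw [← map_mul, ← map_mul]
    exact (π.comp (FreeMonoid.map Sum.inr)).map_eq_of_conGen hRS
      (hSker _ _ ((map_mul φS a b).trans habc))
  have push (y : XS) (a : FreeMonoid XU) :
      π (FreeMonoid.of (Sum.inr y)) * π (FreeMonoid.map Sum.inl a) =
        π (FreeMonoid.map Sum.inl (NU (act (φS (FreeMonoid.of y)) (φU a)))) *
          π (FreeMonoid.of (Sum.inr y)) := by
    induction a using FreeMonoid.inductionOn' with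
    | one =>
      by_cases h : act (φS (FreeMonoid.of y)) 1 = 1
      · simp [h, hNU1]
      · simpa using hplus y h
    | of_mul x a ih =>
      rw [map_mul, map_mul, FreeMonoid.map_of, ← mul_assoc, hcross, mul_assoc, ih, ← mul_assoc]
      congr 1
      apply hU
      simp [hNU, hhom]
  have normalForm (w : FreeMonoid (XU ⊕ XS)) :
      π w = π (FreeMonoid.map Sum.inl (NU (sdEval act (sdLetter act φU φS) w).1)) *
        π (FreeMonoid.map Sum.inr (NS (sdEval act (sdLetter act φU φS) w).2)) := by
    induction w using FreeMonoid.inductionOn' with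
    | one => simp [sdEval, hNU1, hNS1]
    | of_mul z w ih =>
      have cons : sdEval act (sdLetter act φU φS) (FreeMonoid.of z * w) =
          sdMul act (sdLetter act φU φS z) (sdEval act (sdLetter act φU φS) w) := rfl
      rw [cons, map_mul, ih]
      generalize sdEval act (sdLetter act φU φS) w = p
      obtain ⟨u, s⟩ := p
      cases z with
      | inl x =>
        rw [← FreeMonoid.map_of (f := Sum.inl), ← mul_assoc]
        simp only [sdLetter, sdMul, Sum.elim_inl, one_mul]
        congr 1
        apply hU
        simp [hNU, hone]
      | inr y =>
        rw [← mul_assoc, push, mul_assoc, ← FreeMonoid.map_of (f := Sum.inr)]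
        simp only [sdLetter, sdMul, Sum.elim_inr]
        rw [← hhom, one_mul, hNU]
        congr 1
        apply hS
        simp [hNS]
  rw [normalForm w, normalForm v, h]

/-- Let `S` act monoidally on `U` by semigroup morphisms, with `U, S`
presented monoids (with normal form functions), and let
`M = {(u, s) : u = u·s⁺} ≤ U ⋊ S`.  Then the map `φ` determined on letters by
`x ↦ (x̄, 1)`, `y ↦ (ȳ⁺, ȳ)` maps the free monoid on `X_U ⊕ X_S` onto `M`, and its kernel
is the congruence generated by `R_U ∪ R_S ∪ R₁ ∪ R₃` where
`R₁ = {(yx, N_U(ȳ•x̄)·y)}` and `R₃ = {(y, N_U(ȳ⁺)·y) : ȳ⁺ ≠ 1}`;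
that is, `M` has monoid presentation `Mon⟨X_U ∪ X_S | R_U ∪ R_S ∪ R₁ ∪ R₃⟩` via `φ`. -/
theorem stmt_14 {U S : Type*} [Monoid U] [Monoid S] (act : S → U → U)
    (hone : ∀ u : U, act 1 u = u)
    (hcomp : ∀ (s t : S) (u : U), act (s * t) u = act s (act t u))
    (hhom : ∀ (s : S) (u v : U), act s (u * v) = act s u * act s v)
    {XU XS : Type*}
    (RU : FreeMonoid XU → FreeMonoid XU → Prop)
    (RS : FreeMonoid XS → FreeMonoid XS → Prop)
    (φU : FreeMonoid XU →* U) (φS : FreeMonoid XS →* S)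
    (hUsurj : Function.Surjective φU) (hSsurj : Function.Surjective φS)
    (hUker : ∀ w v, φU w = φU v ↔ conGen RU w v)
    (hSker : ∀ w v, φS w = φS v ↔ conGen RS w v)
    (hUone : ∀ x : XU, φU (FreeMonoid.of x) ≠ 1)
    (hSone : ∀ y : XS, φS (FreeMonoid.of y) ≠ 1)
    (hUinj : ∀ x x' : XU, φU (FreeMonoid.of x) = φU (FreeMonoid.of x') → x = x')
    (hSinj : ∀ y y' : XS, φS (FreeMonoid.of y) = φS (FreeMonoid.of y') → y = y')
    (NU : U → FreeMonoid XU) (NS : S → FreeMonoid XS)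
    (hNU : ∀ u, φU (NU u) = u) (hNS : ∀ s, φS (NS s) = s)
    (hNU1 : NU 1 = 1) (hNS1 : NS 1 = 1) :
    (∀ p : U × S,
      (∃ w : FreeMonoid (XU ⊕ XS), sdEval act (sdLetter act φU φS) w = p) ↔
        p.1 = p.1 * act p.2 1) ∧
    (∀ w v : FreeMonoid (XU ⊕ XS),
      sdEval act (sdLetter act φU φS) w = sdEval act (sdLetter act φU φS) v ↔
        conGen (fun a b : FreeMonoid (XU ⊕ XS) =>
          (∃ w' v', RU w' v' ∧
            a = FreeMonoid.map Sum.inl w' ∧ b = FreeMonoid.map Sum.inl v') ∨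
          (∃ w' v', RS w' v' ∧
            a = FreeMonoid.map Sum.inr w' ∧ b = FreeMonoid.map Sum.inr v') ∨
          (∃ (y : XS) (x : XU),
            a = FreeMonoid.of (Sum.inr y) * FreeMonoid.of (Sum.inl x) ∧
            b = FreeMonoid.map Sum.inl
                  (NU (act (φS (FreeMonoid.of y)) (φU (FreeMonoid.of x)))) *
                FreeMonoid.of (Sum.inr y)) ∨
          (∃ y : XS, act (φS (FreeMonoid.of y)) 1 ≠ 1 ∧
            a = FreeMonoid.of (Sum.inr y) ∧
            b = FreeMonoid.map Sum.inl (NU (act (φS (FreeMonoid.of y)) 1)) *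
                FreeMonoid.of (Sum.inr y))) w v) := by
  have emul := sdEval_mul hone hcomp hhom (sdLetter act φU φS)
  have einl := sdEval_map_inl hone φU φS
  have einr := sdEval_map_inr hone hcomp hhom φU φS
  have eof (y : XS) : sdEval act (sdLetter act φU φS) (FreeMonoid.of (Sum.inr y)) =
      (act (φS (FreeMonoid.of y)) 1, φS (FreeMonoid.of y)) := by
    rw [← einr, FreeMonoid.map_of]
  have eofl (x : XU) : sdEval act (sdLetter act φU φS) (FreeMonoid.of (Sum.inl x)) =
      (φU (FreeMonoid.of x), 1) := by
    rw [← einl, FreeMonoid.map_of]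
  refine ⟨fun p => ⟨?_, fun hp => ?_⟩, fun w v => ⟨fun h => ?_, fun h => ?_⟩⟩
  · rintro ⟨w, rfl⟩
    have h := emul w 1
    rw [mul_one] at h
    exact congrArg Prod.fst h
  · refine ⟨FreeMonoid.map Sum.inl (NU p.1) * FreeMonoid.map Sum.inr (NS p.2), ?_⟩
    rw [emul, einl, einr]
    ext <;> simp [sdMul, hNU, hNS, hone, ← hp]
  · rw [← Con.eq]
    change Con.mk' _ w = Con.mk' _ v
    refine map_eq_of_sdEval_eq hone hhom (fun w v => (hUker w v).1) (fun w v => (hSker w v).1)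
      hNU hNS hNU1 hNS1 (Con.mk' _) (fun a b hab => ?_) (fun a b hab => ?_) (fun y x => ?_)
      (fun y hy => ?_) h
    · exact mk'_conGen_eq (Or.inl ⟨a, b, hab, rfl, rfl⟩)
    · exact mk'_conGen_eq (Or.inr (Or.inl ⟨a, b, hab, rfl, rfl⟩))
    · rw [← map_mul, ← map_mul]
      exact mk'_conGen_eq (Or.inr (Or.inr (Or.inl ⟨y, x, rfl, rfl⟩)))
    · rw [← map_mul]
      exact mk'_conGen_eq (Or.inr (Or.inr (Or.inr ⟨y, hy, rfl, rfl⟩)))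
  · let c : Con (FreeMonoid (XU ⊕ XS)) :=
      { Setoid.ker (sdEval act (sdLetter act φU φS)) with
        mul' := fun {a b c d} hab hcd => by
          change sdEval _ _ _ = sdEval _ _ _ at hab hcd ⊢
          rw [emul, emul, hab, hcd] }
    refine (Con.conGen_le (c := c)).2 ?_ h
    intro a b hab
    change sdEval _ _ _ = sdEval _ _ _
    rcases hab with ⟨a, b, hab, rfl, rfl⟩ | ⟨a, b, hab, rfl, rfl⟩ | ⟨y, x, rfl, rfl⟩ |
      ⟨y, -, rfl, rfl⟩
    · rw [einl, einl, (hUker a b).2 (ConGen.Rel.of _ _ hab)]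
    · rw [einr, einr, (hSker a b).2 (ConGen.Rel.of _ _ hab)]
    · rw [emul, emul, einl, eof, eofl]
      simp [sdMul, hNU, hone, ← hhom]
    · rw [emul, einl, eof]
      simp [sdMul, hNU, hone, ← hhom]
end

section
/- Let M be a monoid and let (U, S) be an action pair in M with U and S submonoids: there is a left action (s, u) ↦ s•u of S on U by semigroup morphisms satisfying (A1) su = (s•u)s and (A2) us = vt ⟹ us⁺ = vt⁺ (u, v ∈ U, s, t ∈ S), where s⁺ = s•1; then US = {us : u ∈ U, s ∈ S} is a submonoid of M. Suppose U has monoid presentation Mon⟨X_U | R_U⟩ via φ_U : X_U* → U and S has presentation Mon⟨X_S | R_S⟩ via φ_S : X_S* → S, with X_U, X_S disjoint, no generator sent to 1, φ_U, φ_S injective on letters, and normal form functions N_U : U → X_U*, N_S : S → X_S* satisfying N_U(1) = ε = N_S(1). Write w̄ for images of letters. For each u ∈ U let θ_u = {(s, t) ∈ S × S : us = ut}, a right congruence on S, and let Ω_u ⊆ S × S be a set generating θ_u as a right congruence. Define Φ : (X_U ∪ X_S)* → M on letters by Φ(x) = x̄ (x ∈ X_U) and Φ(y) = ȳ (y ∈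 X_S). Then the image of Φ is US, and the kernel of Φ equals the congruence generated by R_U ∪ R_S ∪ R₁ ∪ R₂ ∪ R₃, where R₁ = {(yx, N_U(ȳ•x̄)·y) : y ∈ X_S, x ∈ X_U}, R₂ = {(N_U(u)N_S(s), N_U(u)N_S(t)) : u ∈ U, (s, t) ∈ Ω_u}, and R₃ = {(y, N_U(ȳ⁺)·y) : y ∈ X_S with ȳ⁺ ≠ 1}; that is, US has monoid presentation Mon⟨X_U ∪ X_S | R_U ∪ R_S ∪ R₁ ∪ R₂ ∪ R₃⟩ via Φ. -/
/-- The canonical homomorphism from the free monoid on `X_U ⊕ X_S` to the ambient monoid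
`M`, sending each letter to the image of the corresponding generator of `U` or `S`. -/
def pairEval {M : Type*} [Monoid M] (U S : Submonoid M) {XU XS : Type*}
    (φU : FreeMonoid XU →* U) (φS : FreeMonoid XS →* S) :
    FreeMonoid (XU ⊕ XS) →* M :=
  FreeMonoid.lift
    (Sum.elim (fun x => (φU (FreeMonoid.of x) : M)) (fun y => (φS (FreeMonoid.of y) : M)))

/-- A homomorphism on a free monoid that respects the relations of a presentation of `T`
factors through `T`. -/
theorem exists_monoidHom_of_presentation {X T Q : Type*} [Monoid T] [Monoid Q]
    {R : FreeMonoid X → FreeMonoid X → Prop} (φ : FreeMonoid X →* T)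
    (hsurj : Function.Surjective φ) (hker : ∀ w v, φ w = φ v ↔ conGen R w v)
    (f : FreeMonoid X →* Q) (hf : ∀ w v, R w v → f w = f v) :
    ∃ α : T →* Q, ∀ w, α (φ w) = f w := by
  have hle : conGen R ≤ Con.ker f := Con.conGen_le.mpr fun w v h => hf w v h
  have key : ∀ w v, φ w = φ v → f w = f v := fun w v h => hle ((hker w v).mp h)
  choose N hN using hsurj
  have hα : ∀ w, f (N (φ w)) = f w := fun w => key _ _ (hN _)
  refine ⟨⟨⟨fun t => f (N t), ?_⟩, fun a b => ?_⟩, hα⟩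
  · rw [← map_one φ, hα, map_one]
  · change f (N (a * b)) = f (N a) * f (N b)
    rw [← map_mul]
    exact key _ _ (by simp [hN])

section ActionPair

variable {M : Type*} [Monoid M] {U S : Submonoid M} {act : S → U → U}

theorem act_one_left
    (hA1 : ∀ (s : S) (u : U), (s : M) * (u : M) = ((act s u : U) : M) * (s : M)) (u : U) :
    act 1 u = u :=
  Subtype.ext (by simpa using (hA1 1 u).symm)

/-- If the commutation rule `β s * α u = α (s • u) * β s` holds for generators, including
`u = 1`, then it holds everywhere. -/
theorem map_mul_map_eq_of_generators {XU XS Q : Type*} [Monoid Q]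
    (hcomp : ∀ (s t : S) (u : U), act (s * t) u = act s (act t u))
    (hhom : ∀ (s : S) (u v : U), act s (u * v) = act s u * act s v)
    (hA1 : ∀ (s : S) (u : U), (s : M) * (u : M) = ((act s u : U) : M) * (s : M))
    {φU : FreeMonoid XU →* U} {φS : FreeMonoid XS →* S}
    (hUsurj : Function.Surjective φU) (hSsurj : Function.Surjective φS)
    {α : U →* Q} {β : S →* Q}
    (hgen : ∀ (y : XS) (x : XU),
      β (φS (FreeMonoid.of y)) * α (φU (FreeMonoid.of x)) =
        α (act (φS (FreeMonoid.of y)) (φU (FreeMonoid.of x))) * β (φS (FreeMonoid.of y)))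
    (hone : ∀ y : XS, β (φS (FreeMonoid.of y)) =
      α (act (φS (FreeMonoid.of y)) 1) * β (φS (FreeMonoid.of y)))
    (s : S) (u : U) : β s * α u = α (act s u) * β s := by
  obtain ⟨b, rfl⟩ := hSsurj s
  induction b using FreeMonoid.inductionOn' generalizing u with
  | one => simp [act_one_left hA1]
  | of_mul y b ihb =>
    have hy : ∀ u, β (φS (FreeMonoid.of y)) * α u =
        α (act (φS (FreeMonoid.of y)) u) * β (φS (FreeMonoid.of y)) := by
      intro u
      obtain ⟨a, rfl⟩ := hUsurj u
      induction a using FreeMonoid.inductionOn' with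
      | one => simpa using hone y
      | of_mul x a iha =>
        rw [map_mul, map_mul, hhom, map_mul, ← mul_assoc, hgen, mul_assoc, iha, mul_assoc]
    rw [map_mul, map_mul, hcomp, mul_assoc, ihb, ← mul_assoc, hy, mul_assoc]

/-- The product `α u * β s` depends only on the element `us` of `M`. -/
theorem map_mul_map_eq_of_mul_eq {Q : Type*} [Monoid Q]
    (hA1 : ∀ (s : S) (u : U), (s : M) * (u : M) = ((act s u : U) : M) * (s : M))
    (hA2 : ∀ (u v : U) (s t : S), (u : M) * (s : M) = (v : M) * (t : M) →
      (u : M) * ((act s 1 : U) : M) = (v : M) * ((act t 1 : U) : M))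
    {Ω : U → S → S → Prop}
    (hΩ : ∀ (u : U) (ρ : S → S → Prop), Equivalence ρ →
      (∀ s t c : S, ρ s t → ρ (s * c) (t * c)) →
      (∀ s t : S, Ω u s t → ρ s t) →
      ∀ s t : S, (u : M) * (s : M) = (u : M) * (t : M) → ρ s t)
    {α : U →* Q} {β : S →* Q}
    (hcomm : ∀ (s : S) (u : U), β s * α u = α (act s u) * β s)
    (hαβ : ∀ (u : U) (s t : S), Ω u s t → α u * β s = α u * β t)
    {u v : U} {s t : S} (h : (u : M) * (s : M) = (v : M) * (t : M)) :
    α u * β s = α v * β t := by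
  have absorb : ∀ (u : U) (s : S), α (u * act s 1) * β s = α u * β s := by
    intro u s
    rw [map_mul, mul_assoc, ← hcomm, map_one, mul_one]
  have absorbM : ∀ (u : U) (s : S), ((u * act s 1 : U) : M) * (s : M) = u * s := by
    intro u s
    have := hA1 s 1
    rw [OneMemClass.coe_one, mul_one] at this
    rw [Submonoid.coe_mul, mul_assoc, ← this]
  have he : u * act s 1 = v * act t 1 := Subtype.ext (hA2 u v s t h)
  rw [← absorb u s, ← absorb v t, ← he]
  refine hΩ (u * act s 1) (fun a b => α (u * act s 1) * β a = α (u * act s 1) * β b)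
    ⟨fun _ => rfl, Eq.symm, Eq.trans⟩ ?_ (hαβ _) s t ?_
  · intro a b c hab
    rw [map_mul β, map_mul β, ← mul_assoc, hab, mul_assoc]
  · rw [absorbM, h, he, absorbM]

end ActionPair

theorem pairEval_map_inl {M : Type*} [Monoid M] (U S : Submonoid M) {XU XS : Type*}
    (φU : FreeMonoid XU →* U) (φS : FreeMonoid XS →* S) (w : FreeMonoid XU) :
    pairEval U S φU φS (FreeMonoid.map Sum.inl w) = φU w := by
  have : (pairEval U S φU φS).comp (FreeMonoid.map Sum.inl) = U.subtype.comp φU :=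
    FreeMonoid.hom_eq fun x => by simp [pairEval]
  exact DFunLike.congr_fun this w

theorem pairEval_map_inr {M : Type*} [Monoid M] (U S : Submonoid M) {XU XS : Type*}
    (φU : FreeMonoid XU →* U) (φS : FreeMonoid XS →* S) (w : FreeMonoid XS) :
    pairEval U S φU φS (FreeMonoid.map Sum.inr w) = φS w := by
  have : (pairEval U S φU φS).comp (FreeMonoid.map Sum.inr) = S.subtype.comp φS :=
    FreeMonoid.hom_eq fun x => by simp [pairEval]
  exact DFunLike.congr_fun this w

/-- Every word on the two alphabets is equal, both in `M` and in `Q`, to a product of an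
element of `U` and an element of `S`. -/
theorem exists_pairEval_eq_mul {M : Type*} [Monoid M] {U S : Submonoid M} {act : S → U → U}
    (hA1 : ∀ (s : S) (u : U), (s : M) * (u : M) = ((act s u : U) : M) * (s : M))
    {XU XS Q : Type*} [Monoid Q] {φU : FreeMonoid XU →* U} {φS : FreeMonoid XS →* S}
    {α : U →* Q} {β : S →* Q} {π : FreeMonoid (XU ⊕ XS) →* Q}
    (hα : ∀ w, α (φU w) = π (FreeMonoid.map Sum.inl w))
    (hβ : ∀ w, β (φS w) = π (FreeMonoid.map Sum.inr w))
    (hcomm : ∀ (s : S) (u : U), β s * α u = α (act s u) * β s)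
    (w : FreeMonoid (XU ⊕ XS)) :
    ∃ (u : U) (s : S), pairEval U S φU φS w = (u : M) * (s : M) ∧ π w = α u * β s := by
  induction w using FreeMonoid.inductionOn' with
  | one => exact ⟨1, 1, by simp, by simp⟩
  | of_mul z w ih =>
    obtain ⟨u, s, hM, hQ⟩ := ih
    rcases z with x | y
    · refine ⟨φU (FreeMonoid.of x) * u, s, ?_, ?_⟩
      · rw [map_mul, hM, ← FreeMonoid.map_of, pairEval_map_inl, Submonoid.coe_mul, mul_assoc]
      · rw [map_mul, hQ, map_mul α, hα, FreeMonoid.map_of, mul_assoc]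
    · refine ⟨act (φS (FreeMonoid.of y)) u, φS (FreeMonoid.of y) * s, ?_, ?_⟩
      · rw [map_mul, hM, ← FreeMonoid.map_of, pairEval_map_inr, Submonoid.coe_mul, ← mul_assoc,
          hA1, mul_assoc]
      · rw [map_mul, hQ, map_mul β, ← mul_assoc, ← mul_assoc, ← hcomm, hβ, FreeMonoid.map_of]

/-- Let `(U, S)` be an action pair in a monoid `M` with `U, S` submonoids,
both given by monoid presentations with normal form functions, and for each `u ∈ U` let
`Ω_u` generate the right congruence `θ_u = {(s, t) : us = ut}` on `S`.  Then the canonical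
map `Φ` from the free monoid on `X_U ⊕ X_S` to `M` has image `US`, and its kernel is the
congruence generated by `R_U ∪ R_S ∪ R₁ ∪ R₂ ∪ R₃`; that is, `US` has monoid presentation
`Mon⟨X_U ∪ X_S | R_U ∪ R_S ∪ R₁ ∪ R₂ ∪ R₃⟩` via `Φ`. -/
theorem stmt_15 {M : Type*} [Monoid M] (U S : Submonoid M) (act : S → U → U)
    (hcomp : ∀ (s t : S) (u : U), act (s * t) u = act s (act t u))
    (hhom : ∀ (s : S) (u v : U), act s (u * v) = act s u * act s v)
    (hA1 : ∀ (s : S) (u : U), (s : M) * (u : M) = ((act s u : U) : M) * (s : M))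
    (hA2 : ∀ (u v : U) (s t : S), (u : M) * (s : M) = (v : M) * (t : M) →
      (u : M) * ((act s 1 : U) : M) = (v : M) * ((act t 1 : U) : M))
    {XU XS : Type*}
    (RU : FreeMonoid XU → FreeMonoid XU → Prop)
    (RS : FreeMonoid XS → FreeMonoid XS → Prop)
    (φU : FreeMonoid XU →* U) (φS : FreeMonoid XS →* S)
    (hUsurj : Function.Surjective φU) (hSsurj : Function.Surjective φS)
    (hUker : ∀ w v, φU w = φU v ↔ conGen RU w v)
    (hSker : ∀ w v, φS w = φS v ↔ conGen RS w v)
    (hUone : ∀ x : XU, φU (FreeMonoid.of x) ≠ 1)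
    (hSone : ∀ y : XS, φS (FreeMonoid.of y) ≠ 1)
    (hUinj : ∀ x x' : XU, φU (FreeMonoid.of x) = φU (FreeMonoid.of x') → x = x')
    (hSinj : ∀ y y' : XS, φS (FreeMonoid.of y) = φS (FreeMonoid.of y') → y = y')
    (NU : U → FreeMonoid XU) (NS : S → FreeMonoid XS)
    (hNU : ∀ u, φU (NU u) = u) (hNS : ∀ s, φS (NS s) = s)
    (hNU1 : NU 1 = 1) (hNS1 : NS 1 = 1)
    (Ω : U → S → S → Prop)
    (hΩ₁ : ∀ (u : U) (s t : S), Ω u s t → (u : M) * (s : M) = (u : M) * (t : M))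
    (hΩ₂ : ∀ (u : U) (ρ : S → S → Prop), Equivalence ρ →
      (∀ s t c : S, ρ s t → ρ (s * c) (t * c)) →
      (∀ s t : S, Ω u s t → ρ s t) →
      ∀ s t : S, (u : M) * (s : M) = (u : M) * (t : M) → ρ s t) :
    (∀ m : M, (∃ w, pairEval U S φU φS w = m) ↔ ∃ (u : U) (s : S), (u : M) * (s : M) = m) ∧
    (∀ w v : FreeMonoid (XU ⊕ XS),
      pairEval U S φU φS w = pairEval U S φU φS v ↔
        conGen (fun a b : FreeMonoid (XU ⊕ XS) =>
          (∃ w' v', RU w' v' ∧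
            a = FreeMonoid.map Sum.inl w' ∧ b = FreeMonoid.map Sum.inl v') ∨
          (∃ w' v', RS w' v' ∧
            a = FreeMonoid.map Sum.inr w' ∧ b = FreeMonoid.map Sum.inr v') ∨
          (∃ (y : XS) (x : XU),
            a = FreeMonoid.of (Sum.inr y) * FreeMonoid.of (Sum.inl x) ∧
            b = FreeMonoid.map Sum.inl
                  (NU (act (φS (FreeMonoid.of y)) (φU (FreeMonoid.of x)))) *
                FreeMonoid.of (Sum.inr y)) ∨
          (∃ (u : U) (s t : S), Ω u s t ∧
            a = FreeMonoid.map Sum.inl (NU u) * FreeMonoid.map Sum.inr (NS s) ∧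
            b = FreeMonoid.map Sum.inl (NU u) * FreeMonoid.map Sum.inr (NS t)) ∨
          (∃ y : XS, act (φS (FreeMonoid.of y)) 1 ≠ 1 ∧
            a = FreeMonoid.of (Sum.inr y) ∧
            b = FreeMonoid.map Sum.inl (NU (act (φS (FreeMonoid.of y)) 1)) *
                FreeMonoid.of (Sum.inr y))) w v) := by
  set R : FreeMonoid (XU ⊕ XS) → FreeMonoid (XU ⊕ XS) → Prop := fun a b => _ ∨ _
  have hrel : ∀ {a b}, R a b → (conGen R).mk' a = (conGen R).mk' b := fun h =>
    (Con.eq _).mpr (ConGen.Rel.of _ _ h)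
  obtain ⟨α, hα⟩ := exists_monoidHom_of_presentation φU hUsurj hUker
    ((conGen R).mk'.comp (FreeMonoid.map Sum.inl))
    fun w v h => hrel (Or.inl ⟨w, v, h, rfl, rfl⟩)
  obtain ⟨β, hβ⟩ := exists_monoidHom_of_presentation φS hSsurj hSker
    ((conGen R).mk'.comp (FreeMonoid.map Sum.inr))
    fun w v h => hrel (Or.inr (Or.inl ⟨w, v, h, rfl, rfl⟩))
  simp only [MonoidHom.comp_apply] at hα hβ
  have hαN : ∀ u, (conGen R).mk' (FreeMonoid.map Sum.inl (NU u)) = α u := fun u => by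
    rw [← hα, hNU]
  have hβN : ∀ s, (conGen R).mk' (FreeMonoid.map Sum.inr (NS s)) = β s := fun s => by
    rw [← hβ, hNS]
  have hcomm : ∀ (s : S) (u : U), β s * α u = α (act s u) * β s := by
    refine map_mul_map_eq_of_generators hcomp hhom hA1 hUsurj hSsurj (fun y x => ?_) fun y => ?_
    · rw [hβ, hα, ← hαN, ← map_mul, ← map_mul, FreeMonoid.map_of, FreeMonoid.map_of]
      exact hrel (Or.inr (Or.inr (Or.inl ⟨y, x, rfl, rfl⟩)))
    · by_cases hy : act (φS (FreeMonoid.of y)) 1 = 1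
      · rw [hy, map_one, one_mul]
      · rw [hβ, ← hαN, ← map_mul, FreeMonoid.map_of]
        exact hrel (Or.inr (Or.inr (Or.inr (Or.inr ⟨y, hy, rfl, rfl⟩))))
  have hαβ : ∀ (u : U) (s t : S), Ω u s t → α u * β s = α u * β t := by
    intro u s t h
    rw [← hαN, ← hβN, ← hβN, ← map_mul, ← map_mul]
    exact hrel (Or.inr (Or.inr (Or.inr (Or.inl ⟨u, s, t, h, rfl, rfl⟩))))
  have hfactor := exists_pairEval_eq_mul hA1 hα hβ hcomm
  refine ⟨fun m => ⟨?_, ?_⟩, fun w v => ⟨fun h => ?_, fun h => ?_⟩⟩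
  · rintro ⟨w, rfl⟩
    obtain ⟨u, s, h, -⟩ := hfactor w
    exact ⟨u, s, h.symm⟩
  · rintro ⟨u, s, rfl⟩
    exact ⟨FreeMonoid.map Sum.inl (NU u) * FreeMonoid.map Sum.inr (NS s), by
      rw [map_mul, pairEval_map_inl, pairEval_map_inr, hNU, hNS]⟩
  · obtain ⟨u, s, hw, hw'⟩ := hfactor w
    obtain ⟨u', t, hv, hv'⟩ := hfactor v
    refine (Con.eq _).mp (?_ : (conGen R).mk' w = (conGen R).mk' v)
    rw [hw', hv']
    exact map_mul_map_eq_of_mul_eq hA1 hA2 hΩ₂ hcomm hαβ (by rw [← hw, ← hv, h])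
  · have hle : conGen R ≤ Con.ker (pairEval U S φU φS) := by
      refine Con.conGen_le.mpr fun a b hab => ?_
      change pairEval U S φU φS a = pairEval U S φU φS b
      rcases hab with ⟨w, v, h, rfl, rfl⟩ | ⟨w, v, h, rfl, rfl⟩ | ⟨y, x, rfl, rfl⟩ |
        ⟨u, s, t, h, rfl, rfl⟩ | ⟨y, -, rfl, rfl⟩
      · rw [pairEval_map_inl, pairEval_map_inl, (hUker w v).mpr (ConGen.Rel.of _ _ h)]
      · rw [pairEval_map_inr, pairEval_map_inr, (hSker w v).mpr (ConGen.Rel.of _ _ h)]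
      · rw [map_mul, map_mul, ← FreeMonoid.map_of, ← FreeMonoid.map_of, pairEval_map_inl,
          pairEval_map_inl, pairEval_map_inr, hNU, hA1]
      · rw [map_mul, map_mul, pairEval_map_inl, pairEval_map_inr, pairEval_map_inr, hNU, hNS, hNS,
          hΩ₁ u s t h]
      · rw [map_mul, ← FreeMonoid.map_of, pairEval_map_inl, pairEval_map_inr, hNU, ← hA1,
          OneMemClass.coe_one, mul_one]
    exact hle h
end

section
/- Let X be a set, let X* be the free monoid of words over X with empty word ε and X⁺ the set of nonempty words, and for w ∈ X* let w↓ denote the set of all prefixes of w (including ε and w). Let 𝒫_X be the monoid of all finite nonempty prefix-closed subsets of X* under union, with identity {ε}. Then Γ_X = {w↓ : w ∈ X⁺} is the unique minimum monoid generating set for 𝒫_X: (i) every element of 𝒫_X is a product (union) of elements of Γ_X, i.e. 𝒫_X is generated as a monoid by Γ_X; and (ii) every monoid generating set of 𝒫_X contains Γ_X (indeed each w↓ with w ∈ X⁺ is an atom: if w↓ = A ∪ B with A, B ∈ 𝒫_X then w↓ = A or w↓ = B). -/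
/-- The set of prefixes `w↓` of a word `w`. -/
def prefixSet {X : Type*} (w : List X) : Set (List X) := {v | v <+: w}

/-- The monoid `𝒫_X` of finite, nonempty, prefix-closed sets of words, under union. -/
def PX (X : Type*) : Set (Set (List X)) :=
  {A | A.Finite ∧ A.Nonempty ∧ ∀ w ∈ A, ∀ v : List X, v <+: w → v ∈ A}

/-- `Γ_X = {w↓ : w ∈ X⁺}`. -/
def GammaX (X : Type*) : Set (Set (List X)) :=
  {B | ∃ w : List X, w ≠ [] ∧ B = prefixSet w}

theorem mem_foldr_union_singleton_nil {X : Type*} (l : List (Set (List X))) (v : List X) :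
    v ∈ l.foldr (· ∪ ·) {[]} ↔ v = [] ∨ ∃ B ∈ l, v ∈ B := by
  induction l with
  | nil => simp
  | cons C l ih =>
    simp only [List.foldr_cons, Set.mem_union, ih, List.mem_cons, exists_eq_or_imp]
    tauto

theorem prefixSet_mem_PX {X : Type*} (w : List X) : prefixSet w ∈ PX X := by
  refine ⟨?_, ⟨w, List.prefix_refl w⟩, fun u hu v hv => hv.trans hu⟩
  refine w.inits.finite_toSet.subset fun v hv => ?_
  exact (List.mem_inits v w).2 hv

theorem prefixSet_subset {X : Type*} {A : Set (List X)} (hA : A ∈ PX X) {w : List X}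
    (hw : w ∈ A) : prefixSet w ⊆ A :=
  fun v hv => hA.2.2 w hw v hv

theorem nil_mem_of_mem_PX {X : Type*} {A : Set (List X)} (hA : A ∈ PX X) : [] ∈ A :=
  let ⟨w, hw⟩ := hA.2.1
  hA.2.2 w hw [] List.nil_prefix

theorem exists_foldr_union_eq {X : Type*} {A : Set (List X)} (hA : A ∈ PX X) :
    ∃ l : List (Set (List X)), (∀ B ∈ l, B ∈ GammaX X) ∧ A = l.foldr (· ∪ ·) {[]} := by
  classical
  refine ⟨(hA.1.toFinset.erase []).toList.map prefixSet, ?_, ?_⟩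
  · intro B hB
    obtain ⟨w, hw, rfl⟩ := List.mem_map.1 hB
    exact ⟨w, (Finset.mem_erase.1 (Finset.mem_toList.1 hw)).1, rfl⟩
  · ext v
    rw [mem_foldr_union_singleton_nil]
    constructor
    · intro hv
      refine or_iff_not_imp_left.2 fun hne => ⟨prefixSet v, ?_, List.prefix_refl v⟩
      exact List.mem_map_of_mem (by simp [hne, hv])
    · rintro (rfl | ⟨B, hB, hv⟩)
      · exact nil_mem_of_mem_PX hA
      · obtain ⟨w, hw, rfl⟩ := List.mem_map.1 hB
        have hwA : w ∈ A := by
          simp only [Finset.mem_toList, Finset.mem_erase, Set.Finite.mem_toFinset] at hw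
          exact hw.2
        exact prefixSet_subset hA hwA hv

theorem prefixSet_eq_or_eq_of_eq_union {X : Type*} {w : List X} {A B : Set (List X)}
    (hA : A ∈ PX X) (hB : B ∈ PX X) (h : prefixSet w = A ∪ B) :
    prefixSet w = A ∨ prefixSet w = B := by
  have hw : w ∈ A ∪ B := h ▸ List.prefix_refl w
  rcases hw with hw | hw
  · exact .inl ((prefixSet_subset hA hw).antisymm (h ▸ Set.subset_union_left))
  · exact .inr ((prefixSet_subset hB hw).antisymm (h ▸ Set.subset_union_right))

theorem prefixSet_mem_of_eq_foldr_union {X : Type*} {w : List X} (hw : w ≠ [])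
    {l : List (Set (List X))} (hl : ∀ B ∈ l, B ∈ PX X)
    (h : prefixSet w = l.foldr (· ∪ ·) {[]}) : prefixSet w ∈ l := by
  have hmem : w ∈ l.foldr (· ∪ ·) {[]} := h ▸ List.prefix_refl w
  obtain ⟨B, hB, hwB⟩ := ((mem_foldr_union_singleton_nil l w).1 hmem).resolve_left hw
  have hBw : B ⊆ prefixSet w := fun v hv =>
    h ▸ (mem_foldr_union_singleton_nil l v).2 (.inr ⟨B, hB, hv⟩)
  rwa [(prefixSet_subset (hl B hB) hwB).antisymm hBw]

/-- `Γ_X = {w↓ : w ∈ X⁺}` is the unique minimum monoid generating set of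
the monoid `𝒫_X` of finite nonempty prefix-closed sets of words under union (with identity
`{ε}`): (0) `Γ_X ⊆ 𝒫_X`; (i) every element of `𝒫_X` is a (finite, possibly empty) union of
elements of `Γ_X`; (ii) each `w↓` (`w ∈ X⁺`) is an atom, and every monoid generating set of
`𝒫_X` contains `Γ_X`. -/
theorem stmt_16 {X : Type*} :
    GammaX X ⊆ PX X ∧
    (∀ A ∈ PX X, ∃ l : List (Set (List X)),
      (∀ B ∈ l, B ∈ GammaX X) ∧ A = l.foldr (· ∪ ·) {[]}) ∧
    (∀ w : List X, w ≠ [] → ∀ A ∈ PX X, ∀ B ∈ PX X,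
      prefixSet w = A ∪ B → prefixSet w = A ∨ prefixSet w = B) ∧
    (∀ G ⊆ PX X,
      (∀ A ∈ PX X, ∃ l : List (Set (List X)),
        (∀ B ∈ l, B ∈ G) ∧ A = l.foldr (· ∪ ·) {[]}) →
      GammaX X ⊆ G) := by
  refine ⟨?_, fun A hA => exists_foldr_union_eq hA,
    fun w _ A hA B hB h => prefixSet_eq_or_eq_of_eq_union hA hB h, ?_⟩
  · rintro _ ⟨w, -, rfl⟩
    exact prefixSet_mem_PX w
  · rintro G hG hgen _ ⟨w, hw, rfl⟩
    obtain ⟨l, hl, h⟩ := hgen _ (prefixSet_mem_PX w)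
    exact hl _ (prefixSet_mem_of_eq_foldr_union hw (fun B hB => hG (hl B hB)) h)
end

section
/- Let X be a set and let 𝒫_X be the monoid of all finite nonempty prefix-closed subsets of the free monoid X*, under union, with identity {ε}. Let A_X = {a_w : w ∈ X⁺} be an alphabet in bijection with the nonempty words, and let φ_X : A_X* → 𝒫_X be the monoid homomorphism with φ_X(a_w) = w↓ (the set of prefixes of w). Then φ_X is surjective and its kernel is the congruence on A_X* generated by R_X = R_X¹ ∪ R_X², where R_X¹ = {(a_w a_v, a_v a_w) : w, v ∈ X⁺} and R_X² = {(a_{wv} a_w, a_{wv}) : w ∈ X⁺, v ∈ X*}; that is, 𝒫_X has monoid presentation Mon⟨A_X | R_X⟩ via φ_X. -/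
theorem append_ne_nil_left' {X : Type*} {u : List X} (hu : u ≠ []) (v : List X) :
    u ++ v ≠ [] := by
  cases u <;> simp_all

/-- Evaluation in `𝒫_X` (sets of words under union, identity `{ε}`) of a word over the
alphabet `A_X = {a_w : w ∈ X⁺}`, where `a_w ↦ w↓`. -/
def pxEval {X : Type*} (w : FreeMonoid {w : List X // w ≠ []}) : Set (List X) :=
  (FreeMonoid.toList w).foldr (fun a A => {v : List X | v <+: a.1} ∪ A) {[]}

theorem mem_pxEval {X : Type*} {w : FreeMonoid {w : List X // w ≠ []}} {x : List X} :
    x ∈ pxEval w ↔ x = [] ∨ ∃ a ∈ FreeMonoid.toList w, x <+: a.1 := by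
  have key : ∀ l : List {w : List X // w ≠ []},
      x ∈ l.foldr (fun a A => {v : List X | v <+: a.1} ∪ A) {[]} ↔
        x = [] ∨ ∃ a ∈ l, x <+: a.1 := by
    intro l
    induction l with
    | nil => simp
    | cons a l ih =>
      rw [List.foldr_cons, Set.mem_union, ih, List.exists_mem_cons_iff, Set.mem_ofPred_eq]
      tauto
  exact key _

theorem pxEval_mul {X : Type*} (p q : FreeMonoid {w : List X // w ≠ []}) :
    pxEval (p * q) = pxEval p ∪ pxEval q := by
  ext x
  simp only [Set.mem_union, mem_pxEval, FreeMonoid.toList_mul, List.mem_append, or_and_right,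
    exists_or]
  exact or_or_distrib_left

theorem pxEval_of {X : Type*} (a : {w : List X // w ≠ []}) :
    pxEval (FreeMonoid.of a) = {v | v <+: a.1} := by
  ext x
  rw [mem_pxEval, Set.mem_ofPred_eq]
  simp only [FreeMonoid.toList_of, List.mem_singleton, exists_eq_left]
  exact or_iff_right_of_imp <| by
    rintro rfl
    exact List.nil_prefix

theorem finite_pxEval {X : Type*} (w : FreeMonoid {w : List X // w ≠ []}) :
    (pxEval w).Finite := by
  have h : pxEval w ⊆ {[]} ∪ ⋃ a ∈ {a | a ∈ FreeMonoid.toList w}, {v | v ∈ a.1.inits} := by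
    intro x hx
    simpa [mem_pxEval] using hx
  exact ((Set.finite_singleton _).union
    ((List.finite_toSet _).biUnion fun a _ => List.finite_toSet _)).subset h

theorem exists_pxEval_eq {X : Type*} {A : Set (List X)} (hfin : A.Finite) (hne : A.Nonempty)
    (hA : ∀ u ∈ A, ∀ v : List X, v <+: u → v ∈ A) :
    ∃ w : FreeMonoid {w : List X // w ≠ []}, pxEval w = A := by
  have hS : (Subtype.val ⁻¹' A : Set {w : List X // w ≠ []}).Finite :=
    hfin.preimage Subtype.val_injective.injOn
  refine ⟨FreeMonoid.ofList hS.toFinset.toList, ?_⟩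
  ext x
  simp only [mem_pxEval, FreeMonoid.toList_ofList, Finset.mem_toList, Set.Finite.mem_toFinset,
    Set.mem_preimage]
  constructor
  · rintro (rfl | ⟨a, ha, hx⟩)
    · obtain ⟨u, hu⟩ := hne
      exact hA u hu _ List.nil_prefix
    · exact hA _ ha _ hx
  · intro hx
    by_cases h : x = []
    · exact Or.inl h
    · exact Or.inr ⟨⟨x, h⟩, hx, List.prefix_rfl⟩

/-- The kernel congruence of `pxEval`. -/
def pxEvalKer (X : Type*) : Con (FreeMonoid {w : List X // w ≠ []}) where
  r p q := pxEval p = pxEval q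
  iseqv := ⟨fun _ => rfl, fun h => h.symm, fun h h' => h.trans h'⟩
  mul' {p q p' q'} h h' := by
    rw [pxEval_mul, pxEval_mul, h, h']

theorem FreeMonoid.con_mul_comm {α : Type*} (c : Con (FreeMonoid α))
    (hcomm : ∀ a b : α, c (of a * of b) (of b * of a)) (p q : FreeMonoid α) :
    c (p * q) (q * p) := by
  have letter : ∀ (a : α) (q : FreeMonoid α), c (of a * q) (q * of a) := by
    intro a q
    induction q using FreeMonoid.inductionOn' with
    | one => simpa using c.refl _
    | of_mul b q ih =>
      have h₁ := c.mul (hcomm a b) (c.refl q)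
      have h₂ := c.mul (c.refl (of b)) ih
      simp only [mul_assoc] at h₁ h₂ ⊢
      exact c.trans h₁ h₂
  induction p using FreeMonoid.inductionOn' with
  | one => simpa using c.refl _
  | of_mul a p ih =>
    have h₁ := c.mul (c.refl (of a)) ih
    have h₂ := c.mul (letter a q) (c.refl p)
    simp only [mul_assoc] at h₁ h₂ ⊢
    exact c.trans h₁ h₂

/-- A letter is absorbed by any word containing a letter that absorbs it. -/
theorem FreeMonoid.con_of_mul_of_mem {α : Type*} (c : Con (FreeMonoid α))
    (hcomm : ∀ a b : α, c (of a * of b) (of b * of a)) {a b : α}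
    (hab : c (of a * of b) (of a)) {p : FreeMonoid α} (ha : a ∈ toList p) :
    c (of b * p) p := by
  obtain ⟨s, t, hst⟩ := List.append_of_mem ha
  have hp : p = ofList s * (of a * ofList t) := hst
  have h₁ := c.mul (con_mul_comm c hcomm (of b) (ofList s * of a)) (c.refl (ofList t))
  have h₂ := c.mul (c.mul (c.refl (ofList s)) hab) (c.refl (ofList t))
  rw [hp]
  simp only [mul_assoc] at h₁ h₂ ⊢
  exact c.trans h₁ h₂

/-- In the presence of the defining relations, a word absorbs every word of smaller value. -/
theorem con_mul_of_pxEval_subset {X : Type*} (c : Con (FreeMonoid {w : List X // w ≠ []}))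
    (hcomm : ∀ a b, c (FreeMonoid.of a * FreeMonoid.of b) (FreeMonoid.of b * FreeMonoid.of a))
    (habs : ∀ a b : {w : List X // w ≠ []}, b.1 <+: a.1 →
      c (FreeMonoid.of a * FreeMonoid.of b) (FreeMonoid.of a))
    {w p : FreeMonoid {w : List X // w ≠ []}} (h : pxEval w ⊆ pxEval p) :
    c (w * p) p := by
  induction w using FreeMonoid.inductionOn' with
  | one => simpa using c.refl _
  | of_mul b w ih =>
    rw [pxEval_mul, pxEval_of, Set.union_subset_iff] at h
    obtain ⟨a, ha, hba⟩ := (mem_pxEval.1 (h.1 (List.prefix_rfl (l := b.1)))).resolve_left b.2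
    rw [mul_assoc]
    exact c.trans (c.mul (c.refl _) (ih h.2))
      (FreeMonoid.con_of_mul_of_mem c hcomm (habs a b hba) ha)

/-- The monoid `𝒫_X` of finite nonempty prefix-closed sets of words under
union has monoid presentation `Mon⟨A_X | R_X⟩` via `a_w ↦ w↓`, where
`R_X = {(a_w a_v, a_v a_w)} ∪ {(a_{wv} a_w, a_{wv})}`: the evaluation map is surjective
onto `𝒫_X` and its kernel is the congruence generated by `R_X`. -/
theorem stmt_17 {X : Type*} :
    (∀ A : Set (List X),
      (∃ w : FreeMonoid {w : List X // w ≠ []}, pxEval w = A) ↔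
        (A.Finite ∧ A.Nonempty ∧ ∀ u ∈ A, ∀ v : List X, v <+: u → v ∈ A)) ∧
    (∀ w v : FreeMonoid {w : List X // w ≠ []},
      pxEval w = pxEval v ↔
        conGen (fun p q : FreeMonoid {w : List X // w ≠ []} =>
          (∃ a b : {w : List X // w ≠ []},
            p = FreeMonoid.of a * FreeMonoid.of b ∧
            q = FreeMonoid.of b * FreeMonoid.of a) ∨
          (∃ (u v' : List X) (hu : u ≠ []),
            p = FreeMonoid.of ⟨u ++ v', append_ne_nil_left' hu v'⟩ * FreeMonoid.of ⟨u, hu⟩ ∧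
            q = FreeMonoid.of ⟨u ++ v', append_ne_nil_left' hu v'⟩)) w v) := by
  refine ⟨fun A => ⟨?_, fun ⟨hfin, hne, hA⟩ => exists_pxEval_eq hfin hne hA⟩, fun w v => ⟨?_, ?_⟩⟩
  · rintro ⟨w, rfl⟩
    refine ⟨finite_pxEval w, ⟨[], mem_pxEval.2 (Or.inl rfl)⟩, fun u hu v hvu => ?_⟩
    rw [mem_pxEval] at hu ⊢
    rcases hu with rfl | ⟨a, ha, hua⟩
    · exact Or.inl (List.prefix_nil.1 hvu)
    · exact Or.inr ⟨a, ha, hvu.trans hua⟩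
  · intro h
    generalize hc : conGen (M := FreeMonoid {w : List X // w ≠ []}) _ = c
    have hcomm : ∀ a b, c (FreeMonoid.of a * FreeMonoid.of b)
        (FreeMonoid.of b * FreeMonoid.of a) := by
      subst hc
      exact fun a b => ConGen.Rel.of _ _ (Or.inl ⟨a, b, rfl, rfl⟩)
    have habs : ∀ a b : {w : List X // w ≠ []}, b.1 <+: a.1 →
        c (FreeMonoid.of a * FreeMonoid.of b) (FreeMonoid.of a) := by
      subst hc
      rintro ⟨_, ha⟩ ⟨u, hu⟩ ⟨v', rfl⟩
      exact ConGen.Rel.of _ _ (Or.inr ⟨u, v', hu, rfl, rfl⟩)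
    exact c.trans (c.symm (con_mul_of_pxEval_subset c hcomm habs h.ge))
      (c.trans (FreeMonoid.con_mul_comm c hcomm v w)
        (con_mul_of_pxEval_subset c hcomm habs h.le))
  · intro h
    refine (Con.conGen_le (c := pxEvalKer X)).2 ?_ h
    rintro p q (⟨a, b, rfl, rfl⟩ | ⟨u, v', hu, rfl, rfl⟩)
    · change pxEval _ = pxEval _
      rw [pxEval_mul, pxEval_mul, Set.union_comm]
    · change pxEval _ = pxEval _
      rw [pxEval_mul, pxEval_of, pxEval_of]
      exact Set.union_eq_left.2 fun x hx => hx.trans (List.prefix_append u v')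
end

section
/- Let X be a set and let L_X = {(A, w) : A ∈ 𝒫_X, w ∈ A} be the free left restriction monoid over X, a monoid under (A, w)(B, v) = (A ∪ wB, wv) with identity ({ε}, ε), where wB = {wb : b ∈ B}. Let A_X = {a_w : w ∈ X⁺} and let Φ_X : (A_X ∪ X)* → L_X be the monoid homomorphism determined on letters by Φ_X(a_w) = (w↓, ε) for w ∈ X⁺ and Φ_X(x) = (x↓, x) = ({ε, x}, x) for x ∈ X. Then Φ_X is surjective and its kernel is the congruence generated by R_X ∪ R₁ ∪ R₂, where R_X = {(a_w a_v, a_v a_w) : w, v ∈ X⁺} ∪ {(a_{wv} a_w, a_{wv}) : w ∈ X⁺, v ∈ X*}, R₁ = {(x a_w, a_{xw} x) : x ∈ X, w ∈ X⁺} and R₂ = {(x, a_x x) : x ∈ X}; that is, L_X has monoid presentation Mon⟨A_X ∪ X | R_X ∪ R₁ ∪ R₂⟩ via Φ_X. -/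
/-- The multiplication `(A, w)(B, v) = (A ∪ wB, wv)` of the free left restriction
monoid `L_X`. -/
def lrMul {X : Type*} (p q : Set (List X) × List X) : Set (List X) × List X :=
  (p.1 ∪ (fun b => p.2 ++ b) '' q.1, p.2 ++ q.2)

/-- The images of the letters: `a_w ↦ (w↓, ε)` for `w ∈ X⁺`, and `x ↦ (x↓, x) = ({ε, x}, x)`
for `x ∈ X`. -/
def lrLetter {X : Type*} : {w : List X // w ≠ []} ⊕ X → Set (List X) × List X :=
  Sum.elim (fun a => ({v : List X | v <+: a.1}, []))
    (fun x => ({v : List X | v <+: [x]}, [x]))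

/-- Evaluation in the free left restriction monoid `L_X ⊆ 𝒫_X × X*` of a word over the
alphabet `A_X ∪ X` (the canonical homomorphic extension of `lrLetter`). -/
def lrEval {X : Type*} (w : FreeMonoid ({w : List X // w ≠ []} ⊕ X)) :
    Set (List X) × List X :=
  (FreeMonoid.toList w).foldr (fun y p => lrMul (lrLetter y) p) ({[]}, [])

section Evaluation

variable {X : Type*}

theorem lrEval_one : lrEval (1 : FreeMonoid ({w : List X // w ≠ []} ⊕ X)) = ({[]}, []) := rfl

theorem lrEval_of_mul (y : {w : List X // w ≠ []} ⊕ X)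
    (t : FreeMonoid ({w : List X // w ≠ []} ⊕ X)) :
    lrEval (FreeMonoid.of y * t) = lrMul (lrLetter y) (lrEval t) := rfl

theorem lrMul_assoc (p q r : Set (List X) × List X) :
    lrMul (lrMul p q) r = lrMul p (lrMul q r) := by
  simp [lrMul, Set.image_union, Set.image_image, Set.union_assoc]

/-- The carrier of the free left restriction monoid. -/
def IsLeftRestrictionPair (p : Set (List X) × List X) : Prop :=
  p.1.Finite ∧ p.1.Nonempty ∧ (∀ u ∈ p.1, ∀ v : List X, v <+: u → v ∈ p.1) ∧ p.2 ∈ p.1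

theorem IsLeftRestrictionPair.nil_mem {p : Set (List X) × List X}
    (h : IsLeftRestrictionPair p) : [] ∈ p.1 :=
  h.2.2.1 _ h.2.2.2 _ List.nil_prefix

theorem finite_setOf_prefix (w : List X) : {v : List X | v <+: w}.Finite :=
  (List.finite_toSet w.inits).subset fun v hv => by simpa using hv

theorem isLeftRestrictionPair_prefixes {u w : List X} (h : u <+: w) :
    IsLeftRestrictionPair ({v : List X | v <+: w}, u) :=
  ⟨finite_setOf_prefix w, ⟨u, h⟩, fun _ hu _ hv => hv.trans hu, h⟩

theorem IsLeftRestrictionPair.lrMul {p q : Set (List X) × List X}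
    (hp : IsLeftRestrictionPair p) (hq : IsLeftRestrictionPair q) :
    IsLeftRestrictionPair (lrMul p q) := by
  refine ⟨hp.1.union (hq.1.image _), hp.2.1.inl, ?_, Or.inr ⟨_, hq.2.2.2, rfl⟩⟩
  rintro u (hu | ⟨b, hb, rfl⟩) v hv
  · exact Or.inl (hp.2.2.1 _ hu _ hv)
  · rcases List.prefix_or_prefix_of_prefix hv (List.prefix_append p.2 b) with h | ⟨t, rfl⟩
    · exact Or.inl (hp.2.2.1 _ hp.2.2.2 _ h)
    · exact Or.inr ⟨t, hq.2.2.1 _ hb _ ((List.prefix_append_right_inj _).1 hv), rfl⟩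

theorem isLeftRestrictionPair_lrEval (t : FreeMonoid ({w : List X // w ≠ []} ⊕ X)) :
    IsLeftRestrictionPair (lrEval t) := by
  induction t using FreeMonoid.inductionOn' with
  | one => exact ⟨Set.finite_singleton _, ⟨[], rfl⟩, by simp [lrEval_one], rfl⟩
  | of_mul y t ih =>
    refine IsLeftRestrictionPair.lrMul ?_ ih
    rcases y with a | x
    · exact isLeftRestrictionPair_prefixes List.nil_prefix
    · exact isLeftRestrictionPair_prefixes List.prefix_rfl

theorem lrEval_mul (s t : FreeMonoid ({w : List X // w ≠ []} ⊕ X)) :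
    lrEval (s * t) = lrMul (lrEval s) (lrEval t) := by
  induction s using FreeMonoid.inductionOn' with
  | one =>
    have h := (isLeftRestrictionPair_lrEval t).nil_mem
    simp [lrEval_one, lrMul, h]
  | of_mul y s ih => rw [mul_assoc, lrEval_of_mul, ih, lrEval_of_mul, lrMul_assoc]

theorem lrEval_of (y : {w : List X // w ≠ []} ⊕ X) :
    lrEval (FreeMonoid.of y) = lrLetter y := by
  rw [← mul_one (FreeMonoid.of y), lrEval_of_mul, lrEval_one]
  rcases y with a | x <;> simp [lrMul, lrLetter]

theorem lrEval_ofList_map_inr (w : List X) :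
    lrEval (FreeMonoid.ofList (w.map Sum.inr)) = ({v : List X | v <+: w}, w) := by
  induction w with
  | nil => simp [lrEval_one]
  | cons x w ih =>
    rw [List.map_cons, FreeMonoid.ofList_cons, lrEval_of_mul, ih]
    ext v
    · simp only [lrMul, lrLetter, Sum.elim_inr, Set.mem_union, Set.mem_ofPred_eq, Set.mem_image,
        List.prefix_cons_iff, List.prefix_nil, List.singleton_append]
      constructor
      · rintro ((rfl | ⟨t, rfl, rfl⟩) | ⟨t, ht, rfl⟩) <;> simp_all
      · rintro (rfl | ⟨t, rfl, ht⟩) <;> simp_all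
    · simp [lrMul, lrLetter]

theorem lrEval_ofList_map_inl_append (L : List {w : List X // w ≠ []}) (w : List X) :
    lrEval (FreeMonoid.ofList (L.map Sum.inl ++ w.map Sum.inr)) =
      ({v : List X | (∃ a ∈ L, v <+: a.1) ∨ v <+: w}, w) := by
  induction L with
  | nil => simp [lrEval_ofList_map_inr]
  | cons a L ih =>
    rw [List.map_cons, List.cons_append, FreeMonoid.ofList_cons, lrEval_of_mul, ih]
    ext v <;> simp [lrMul, lrLetter, or_assoc]

theorem exists_lrEval_eq {p : Set (List X) × List X} (hp : IsLeftRestrictionPair p) :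
    ∃ t, lrEval t = p := by
  have hfin : {a : {w : List X // w ≠ []} | a.1 ∈ p.1}.Finite :=
    hp.1.preimage Subtype.val_injective.injOn
  refine ⟨FreeMonoid.ofList (hfin.toFinset.toList.map Sum.inl ++ p.2.map Sum.inr), ?_⟩
  rw [lrEval_ofList_map_inl_append]
  refine Prod.ext (Set.ext fun v => ?_) rfl
  simp only [Finset.mem_toList, Set.Finite.mem_toFinset, Set.mem_ofPred_eq]
  constructor
  · rintro (⟨a, ha, hv⟩ | hv)
    · exact hp.2.2.1 _ ha _ hv
    · exact hp.2.2.1 _ hp.2.2.2 _ hv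
  · intro hv
    by_cases h : v = []
    · exact Or.inr (h ▸ List.nil_prefix)
    · exact Or.inl ⟨⟨v, h⟩, hv, List.prefix_rfl⟩

end Evaluation

section NormalForm

variable {X M : Type*} [Monoid M] {α : List X → M} {β : X → M}

theorem mul_prod_map_eq_prod_map_mul (push : ∀ x u, β x * α u = α (x :: u) * β x) (x : X)
    (L : List (List X)) :
    β x * (L.map α).prod = ((L.map (List.cons x)).map α).prod * β x := by
  induction L with
  | nil => simp
  | cons u L ih =>
    simp only [List.map_cons, List.prod_cons]
    rw [← mul_assoc, push, mul_assoc, ih, ← mul_assoc]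

theorem commute_prod_map (comm : ∀ u v, Commute (α u) (α v)) (u : List X) (L : List (List X)) :
    Commute (α u) (L.map α).prod := by
  refine Commute.list_prod_right _ _ fun m hm => ?_
  obtain ⟨v, -, rfl⟩ := List.mem_map.1 hm
  exact comm u v

theorem commute_prod_map_prod_map (comm : ∀ u v, Commute (α u) (α v)) (K L : List (List X)) :
    Commute (K.map α).prod (L.map α).prod := by
  refine Commute.list_prod_left _ _ fun m hm => ?_
  obtain ⟨v, -, rfl⟩ := List.mem_map.1 hm
  exact commute_prod_map comm v L

theorem prod_map_mul_eq_self (comm : ∀ u v, Commute (α u) (α v))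
    (absorb : ∀ u v, u <+: v → α v * α u = α v) {u v : List X} {L : List (List X)}
    (hv : v ∈ L) (huv : u <+: v) : (L.map α).prod * α u = (L.map α).prod := by
  induction L with
  | nil => simp at hv
  | cons l L ih =>
    rw [List.map_cons, List.prod_cons]
    rcases List.mem_cons.1 hv with rfl | hv
    · rw [mul_assoc, ← (commute_prod_map comm u L).eq, ← mul_assoc, absorb u v huv]
    · rw [mul_assoc, ih hv]

theorem prod_map_mul_prod_map_eq_left (one : α [] = 1) (comm : ∀ u v, Commute (α u) (α v))
    (absorb : ∀ u v, u <+: v → α v * α u = α v) {K L : List (List X)}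
    (h : ∀ u ∈ L, u = [] ∨ ∃ v ∈ K, u <+: v) :
    (K.map α).prod * (L.map α).prod = (K.map α).prod := by
  induction L with
  | nil => simp
  | cons u L ih =>
    rw [List.map_cons, List.prod_cons, ← mul_assoc]
    have hu : (K.map α).prod * α u = (K.map α).prod := by
      rcases h u (by simp) with rfl | ⟨v, hv, huv⟩
      · rw [one, mul_one]
      · exact prod_map_mul_eq_self comm absorb hv huv
    rw [hu, ih fun w hw => h w (by simp [hw])]

theorem exists_normalForm (push : ∀ x u, β x * α u = α (x :: u) * β x) (one : α [] = 1)
    (f : FreeMonoid ({w : List X // w ≠ []} ⊕ X) →* M)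
    (hα : ∀ a : {w : List X // w ≠ []}, f (FreeMonoid.of (Sum.inl a)) = α a.1)
    (hβ : ∀ x, f (FreeMonoid.of (Sum.inr x)) = β x)
    (t : FreeMonoid ({w : List X // w ≠ []} ⊕ X)) :
    ∃ (L : List (List X)) (w : List X),
      lrEval t = ({v : List X | v = [] ∨ ∃ l ∈ L, v <+: l}, w) ∧
      f t = (L.map α).prod * (w.map β).prod := by
  induction t using FreeMonoid.inductionOn' with
  | one => exact ⟨[], [], by simp [lrEval_one], by simp⟩
  | of_mul y t ih =>
    obtain ⟨L, w, he, hf⟩ := ih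
    rcases y with a | x
    · refine ⟨a.1 :: L, w, ?_, by simp [hα, hf, mul_assoc]⟩
      rw [lrEval_of_mul, he]
      ext v
      · simp only [lrMul, lrLetter, Sum.elim_inl, Set.mem_union, Set.mem_ofPred_eq,
          List.nil_append, Set.image_id', List.exists_mem_cons_iff]
        tauto
      · simp [lrMul, lrLetter]
    · refine ⟨[x] :: L.map (List.cons x), x :: w, ?_, ?_⟩
      · rw [lrEval_of_mul, he]
        ext v
        · simp only [lrMul, lrLetter, Sum.elim_inr, Set.mem_union, Set.mem_ofPred_eq,
            Set.mem_image, List.singleton_append, List.exists_mem_cons_iff, List.mem_map,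
            exists_exists_and_eq_and, List.prefix_cons_iff, List.prefix_nil]
          constructor
          · rintro (h | ⟨t, rfl | ⟨l, hl, ht⟩, rfl⟩)
            · exact Or.inr (Or.inl h)
            · exact Or.inr (Or.inl (Or.inr ⟨[], rfl, rfl⟩))
            · exact Or.inr (Or.inr ⟨l, hl, Or.inr ⟨t, rfl, ht⟩⟩)
          · rintro (rfl | h | ⟨l, hl, rfl | ⟨t, rfl, ht⟩⟩)
            · exact Or.inl (Or.inl rfl)
            · exact Or.inl h
            · exact Or.inl (Or.inl rfl)
            · exact Or.inr ⟨t, Or.inr ⟨l, hl, ht⟩, rfl⟩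
        · simp [lrMul, lrLetter]
      · have hx : β x = α [x] * β x := by simpa [one] using push x []
        rw [map_mul, hβ, hf, ← mul_assoc, List.map_cons, List.prod_cons, List.map_cons,
          List.prod_cons, mul_assoc (α [x]), ← mul_assoc _ (β x),
          ← mul_prod_map_eq_prod_map_mul push, ← mul_assoc, ← mul_assoc, ← hx]

theorem map_eq_of_lrEval_eq (push : ∀ x u, β x * α u = α (x :: u) * β x) (one : α [] = 1)
    (comm : ∀ u v, Commute (α u) (α v)) (absorb : ∀ u v, u <+: v → α v * α u = α v)
    (f : FreeMonoid ({w : List X // w ≠ []} ⊕ X) →* M)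
    (hα : ∀ a : {w : List X // w ≠ []}, f (FreeMonoid.of (Sum.inl a)) = α a.1)
    (hβ : ∀ x, f (FreeMonoid.of (Sum.inr x)) = β x)
    {s t : FreeMonoid ({w : List X // w ≠ []} ⊕ X)} (h : lrEval s = lrEval t) : f s = f t := by
  obtain ⟨K, w, hs, hfs⟩ := exists_normalForm push one f hα hβ s
  obtain ⟨L, w', ht, hft⟩ := exists_normalForm push one f hα hβ t
  rw [hs, ht, Prod.mk.injEq] at h
  obtain ⟨hset, rfl⟩ := h
  have hLK : (K.map α).prod * (L.map α).prod = (K.map α).prod :=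
    prod_map_mul_prod_map_eq_left one comm absorb fun u hu =>
      (Set.ext_iff.1 hset u).2 (Or.inr ⟨u, hu, List.prefix_rfl⟩)
  have hKL : (L.map α).prod * (K.map α).prod = (L.map α).prod :=
    prod_map_mul_prod_map_eq_left one comm absorb fun u hu =>
      (Set.ext_iff.1 hset u).1 (Or.inr ⟨u, hu, List.prefix_rfl⟩)
  rw [hfs, hft, ← hLK, (commute_prod_map_prod_map comm K L).eq, hKL]

end NormalForm

/-- The kernel congruence of the evaluation map. -/
def lrEvalCon (X : Type*) : Con (FreeMonoid ({w : List X // w ≠ []} ⊕ X)) where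
  r s t := lrEval s = lrEval t
  iseqv := ⟨fun _ => rfl, Eq.symm, Eq.trans⟩
  mul' h h' := by rw [lrEval_mul, lrEval_mul, h, h']

/-- The free left restriction monoid
`L_X = {(A, w) : A ∈ 𝒫_X, w ∈ A}`, with `(A, w)(B, v) = (A ∪ wB, wv)`, has monoid
presentation `Mon⟨A_X ∪ X | R_X ∪ R₁ ∪ R₂⟩` via `a_w ↦ (w↓, ε)`, `x ↦ (x↓, x)`, where
`R_X = {(a_w a_v, a_v a_w)} ∪ {(a_{wv} a_w, a_{wv})}`, `R₁ = {(x a_w, a_{xw} x)}` and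
`R₂ = {(x, a_x x)}`: the evaluation map has image `L_X` and its kernel is the congruence
generated by these relations. -/
theorem stmt_18 {X : Type*} :
    (∀ p : Set (List X) × List X,
      (∃ w : FreeMonoid ({w : List X // w ≠ []} ⊕ X), lrEval w = p) ↔
        (p.1.Finite ∧ p.1.Nonempty ∧ (∀ u ∈ p.1, ∀ v : List X, v <+: u → v ∈ p.1) ∧
          p.2 ∈ p.1)) ∧
    (∀ w v : FreeMonoid ({w : List X // w ≠ []} ⊕ X),
      lrEval w = lrEval v ↔
        conGen (fun c d : FreeMonoid ({w : List X // w ≠ []} ⊕ X) =>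
          (∃ a b : {w : List X // w ≠ []},
            c = FreeMonoid.of (Sum.inl a) * FreeMonoid.of (Sum.inl b) ∧
            d = FreeMonoid.of (Sum.inl b) * FreeMonoid.of (Sum.inl a)) ∨
          (∃ (u v' : List X) (hu : u ≠ []),
            c = FreeMonoid.of (Sum.inl ⟨u ++ v', append_ne_nil_left' hu v'⟩) *
                FreeMonoid.of (Sum.inl ⟨u, hu⟩) ∧
            d = FreeMonoid.of (Sum.inl ⟨u ++ v', append_ne_nil_left' hu v'⟩)) ∨
          (∃ (x : X) (u : List X) (hu : u ≠ []),
            c = FreeMonoid.of (Sum.inr x) * FreeMonoid.of (Sum.inl ⟨u, hu⟩) ∧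
            d = FreeMonoid.of (Sum.inl ⟨x :: u, List.cons_ne_nil x u⟩) *
                FreeMonoid.of (Sum.inr x)) ∨
          (∃ x : X,
            c = FreeMonoid.of (Sum.inr x) ∧
            d = FreeMonoid.of (Sum.inl ⟨[x], List.cons_ne_nil x []⟩) *
                FreeMonoid.of (Sum.inr x))) w v) := by
  refine ⟨fun p => ⟨?_, exists_lrEval_eq⟩, fun s t => ⟨fun h => ?_, fun h => ?_⟩⟩
  · rintro ⟨t, rfl⟩
    exact isLeftRestrictionPair_lrEval t
  · rw [← Con.eq]
    set c := conGen (M := FreeMonoid ({w : List X // w ≠ []} ⊕ X)) _ with hc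
    classical
    let α : List X → c.Quotient := fun u =>
      if hu : u = [] then 1 else c.mk' (FreeMonoid.of (Sum.inl ⟨u, hu⟩))
    have one : α [] = 1 := dif_pos rfl
    have hα (u : List X) (hu : u ≠ []) : α u = c.mk' (FreeMonoid.of (Sum.inl ⟨u, hu⟩)) :=
      dif_neg hu
    refine map_eq_of_lrEval_eq (α := α) (β := fun x => c.mk' (FreeMonoid.of (Sum.inr x)))
      ?_ one ?_ ?_ c.mk' (fun a => (hα a.1 a.2).symm) (fun _ => rfl) h
    · intro x u
      rw [hα (x :: u) (List.cons_ne_nil x u), ← map_mul]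
      by_cases hu : u = []
      · subst hu
        rw [one, mul_one]
        exact (Con.eq c).2 (ConGen.Rel.of _ _ (Or.inr (Or.inr (Or.inr ⟨x, rfl, rfl⟩))))
      · rw [hα u hu, ← map_mul]
        exact (Con.eq c).2
          (ConGen.Rel.of _ _ (Or.inr (Or.inr (Or.inl ⟨x, u, hu, rfl, rfl⟩))))
    · intro u v
      by_cases hu : u = []
      · rw [hu, one]
        exact Commute.one_left _
      by_cases hv : v = []
      · rw [hv, one]
        exact Commute.one_right _
      rw [hα u hu, hα v hv, Commute, SemiconjBy, ← map_mul, ← map_mul]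
      exact (Con.eq c).2 (ConGen.Rel.of _ _ (Or.inl ⟨⟨u, hu⟩, ⟨v, hv⟩, rfl, rfl⟩))
    · rintro u _ ⟨v, rfl⟩
      by_cases hu : u = []
      · rw [hu, one, mul_one]
      rw [hα u hu, hα (u ++ v) (append_ne_nil_left' hu v), ← map_mul]
      exact (Con.eq c).2 (ConGen.Rel.of _ _ (Or.inr (Or.inl ⟨u, v, hu, rfl, rfl⟩)))
  · refine Con.conGen_le (c := lrEvalCon X) |>.2 ?_ h
    rintro _ _ (⟨a, b, rfl, rfl⟩ | ⟨u, v, hu, rfl, rfl⟩ | ⟨x, u, hu, rfl, rfl⟩ | ⟨x, rfl, rfl⟩)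
    · change lrEval _ = lrEval _
      simp [lrEval_mul, lrEval_of, lrMul, lrLetter, Set.union_comm]
    · change lrEval _ = lrEval _
      simp only [lrEval_mul, lrEval_of, lrMul, lrLetter, Sum.elim_inl, List.nil_append,
        Set.image_id', Prod.mk.injEq, and_true, Set.union_eq_left]
      exact fun w hw => hw.trans (List.prefix_append u v)
    · change lrEval _ = lrEval _
      ext v
      · simp only [lrEval_mul, lrEval_of, lrMul, lrLetter, Sum.elim_inl, Sum.elim_inr,
          List.nil_append, Set.image_id', List.singleton_append, Set.mem_union,
          Set.mem_ofPred_eq, Set.mem_image, List.prefix_cons_iff (l₂ := u),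
          List.prefix_cons_iff (l₂ := [])]
        aesop
      · simp [lrEval_mul, lrEval_of, lrMul, lrLetter]
    · change lrEval _ = lrEval _
      simp [lrEval_mul, lrEval_of, lrMul, lrLetter]
end

section
/- Let M be a monoid with monoid presentation Mon⟨X_M | R_M⟩ via a surjective homomorphism φ_M : X_M* → M whose kernel is the congruence generated by R_M, and let n ≥ 2. Let S_n be the symmetric group on {1, …, n}, with maps written to the right of their arguments and composed left to right, and let M ≀ S_n be the wreath product: the monoid on Mⁿ × S_n with multiplication (a, π)(b, ρ) = (a·(π•b), πρ), where (π•b)_i = b_{iπ} and (a·c)_i = a_i c_i. Take generators Y = {x⁽ⁱ⁾ : x ∈ X_M, 1 ≤ i ≤ n} ∪ {s_1, …, s_{n−1}} and let Ψ : Y* → M ≀ S_n send x⁽ⁱ⁾ to (the tuple with φ_M(x) in position i and 1 elsewhere, identity permutation) and s_i to (the all-1 tuple, the transposition swapping i and i+1). For a word w = x₁⋯x_k ∈ X_M* write w⁽ⁱ⁾ = x₁⁽ⁱ⁾⋯x_k⁽ⁱ⁾. Then Ψ is surjective and its kernel is the congruence generated by the union of: (a) {(w⁽ⁱ⁾, v⁽ⁱ⁾)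 : (w, v) ∈ R_M, 1 ≤ i ≤ n}; (b) {(x⁽ⁱ⁾y⁽ʲ⁾, y⁽ʲ⁾x⁽ⁱ⁾) : x, y ∈ X_M, i ≠ j}; (c) the Coxeter relations {(s_i², ε)} ∪ {(s_i s_j, s_j s_i) : |i−j| > 1} ∪ {(s_i s_j s_i, s_j s_i s_j) : |i−j| = 1}; and (d) {(s_i x⁽ᵏ⁾, x⁽ᵏ'⁾ s_i) : x ∈ X_M, 1 ≤ i ≤ n−1, 1 ≤ k ≤ n}, where k′ = i+1 if k = i, k′ = i if k = i+1, and k′ = k otherwise. That is, M ≀ S_n has monoid presentation with these generators and relations via Ψ. -/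
/-- The multiplication of the wreath product `M ≀ S_n` on `(Fin n → M) × Perm (Fin n)`:
`(a, π)(b, ρ) = (a·(π•b), πρ)` where `(π•b)_i = b_{iπ}` and permutations are composed left
to right (`i(πρ) = (iπ)ρ`, i.e. `π.trans ρ`). -/
def wrMul {M : Type*} [Monoid M] {n : ℕ} (p q : (Fin n → M) × Equiv.Perm (Fin n)) :
    (Fin n → M) × Equiv.Perm (Fin n) :=
  (fun i => p.1 i * q.1 (p.2 i), p.2.trans q.2)

/-- Evaluation of a word in the wreath product (canonical homomorphic extension of a letter
map `f`). -/
def wrEval {M : Type*} [Monoid M] {n : ℕ} {Y : Type*}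
    (f : Y → (Fin n → M) × Equiv.Perm (Fin n)) (w : FreeMonoid Y) :
    (Fin n → M) × Equiv.Perm (Fin n) :=
  (FreeMonoid.toList w).foldr (fun y p => wrMul (f y) p) (fun _ => 1, Equiv.refl (Fin n))

/-- The images of the generators of `M ≀ S_n` (here `n = m + 2`): `x⁽ⁱ⁾` maps to the tuple
with `φ_M(x)` in position `i` and `1` elsewhere (with the identity permutation), and `s_i`
maps to the all-ones tuple together with the transposition swapping positions `i` and
`i + 1`. -/
def wrLetter {M : Type*} [Monoid M] {X : Type*} (φM : FreeMonoid X →* M) (m : ℕ) :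
    (X × Fin (m + 2)) ⊕ Fin (m + 1) → (Fin (m + 2) → M) × Equiv.Perm (Fin (m + 2)) :=
  Sum.elim
    (fun xi => (fun j => if j = xi.2 then φM (FreeMonoid.of xi.1) else 1, Equiv.refl _))
    (fun i => (fun _ => 1, Equiv.swap i.castSucc i.succ))

section Coxeter

variable {Q : Type*} [Monoid Q]

/-- The descending product `t (n-1) * ⋯ * t (j+1) * t j`, equal to `1` if `n ≤ j`. -/
def descProd (t : ℕ → Q) : ℕ → ℕ → Q
  | 0, _ => 1
  | n + 1, j => if j ≤ n then t n * descProd t n j else 1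

/-- The submonoid generated by the `t i` with `i < n`. -/
def initialClosure (t : ℕ → Q) (n : ℕ) : Submonoid Q :=
  Submonoid.closure (t '' Set.Iio n)

/-- The Coxeter relations of type `A_K` for `t 0, …, t (K-1)`. -/
structure IsCoxeterA (t : ℕ → Q) (K : ℕ) : Prop where
  sq : ∀ i < K, t i * t i = 1
  comm : ∀ i j, i + 1 < j → j < K → t i * t j = t j * t i
  braid : ∀ i, i + 1 < K → t i * t (i + 1) * t i = t (i + 1) * t i * t (i + 1)

variable {t : ℕ → Q} {K : ℕ}

lemma descProd_succ {n j : ℕ} (h : j ≤ n) : descProd t (n + 1) j = t n * descProd t n j := by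
  simp [descProd, h]

lemma descProd_of_le {n j : ℕ} (h : n ≤ j) : descProd t n j = 1 := by
  cases n with
  | zero => rfl
  | succ n => simp [descProd, show ¬ j ≤ n by omega]

lemma mem_initialClosure {i n : ℕ} (h : i < n) : t i ∈ initialClosure t n :=
  Submonoid.subset_closure ⟨i, h, rfl⟩

lemma descProd_mul_pred {n i : ℕ} (h : i < n) :
    descProd t n (i + 1) * t i = descProd t n i := by
  induction n with
  | zero => omega
  | succ n ih =>
    rcases Nat.lt_succ_iff_lt_or_eq.mp h with h' | rfl
    · rw [descProd_succ h', descProd_succ h'.le, mul_assoc, ih h']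
    · rw [descProd_of_le le_rfl, descProd_succ le_rfl, descProd_of_le le_rfl, one_mul, mul_one]

lemma IsCoxeterA.descProd_mul_self (H : IsCoxeterA t K) {n i : ℕ} (h : i < n) (hK : n ≤ K) :
    descProd t n i * t i = descProd t n (i + 1) := by
  rw [← descProd_mul_pred h, mul_assoc, H.sq i (h.trans_le hK), mul_one]

lemma IsCoxeterA.descProd_mul_of_lt (H : IsCoxeterA t K) {n i j : ℕ} (h : i + 1 < j)
    (hK : n ≤ K) : descProd t n j * t i = t i * descProd t n j := by
  induction n with
  | zero => simp [descProd]
  | succ n ih =>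
    rcases le_or_gt j n with h' | h'
    · rw [descProd_succ h', mul_assoc, ih (by omega), ← mul_assoc, ← mul_assoc,
        H.comm i n (by omega) (by omega)]
    · rw [descProd_of_le h', one_mul, mul_one]

lemma IsCoxeterA.descProd_mul_of_length_lt (H : IsCoxeterA t K) {n i j : ℕ} (h : n < i)
    (hK : i < K) : descProd t n j * t i = t i * descProd t n j := by
  induction n with
  | zero => simp [descProd]
  | succ n ih =>
    rcases le_or_gt j n with h' | h'
    · rw [descProd_succ h', mul_assoc, ih (by omega), ← mul_assoc, ← mul_assoc,
        H.comm n i (by omega) hK]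
    · rw [descProd_of_le h', one_mul, mul_one]

lemma IsCoxeterA.descProd_mul_of_gt (H : IsCoxeterA t K) {n i j : ℕ} (h : j ≤ i)
    (hn : i + 1 < n) (hK : n ≤ K) :
    descProd t n j * t (i + 1) = t i * descProd t n j := by
  induction n with
  | zero => omega
  | succ n ih =>
    rw [descProd_succ (by omega)]
    rcases Nat.lt_succ_iff_lt_or_eq.mp hn with h' | rfl
    · rw [mul_assoc, ih h' (by omega), ← mul_assoc, ← mul_assoc,
        H.comm i n (by omega) (by omega)]
    · rw [descProd_succ h, mul_assoc, mul_assoc,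
        H.descProd_mul_of_length_lt (Nat.lt_succ_self i) (by omega)]
      simp only [← mul_assoc]
      rw [H.braid i (by omega)]

/-- Every element of the submonoid on `n + 1` generators lies in a coset of the submonoid on
`n` generators represented by a descending product. -/
lemma IsCoxeterA.exists_eq_mul_descProd (H : IsCoxeterA t K) {n : ℕ} (hK : n + 1 ≤ K) {a : Q}
    (ha : a ∈ initialClosure t (n + 1)) :
    ∃ u ∈ initialClosure t n, ∃ j ≤ n + 1, a = u * descProd t (n + 1) j := by
  induction ha using Submonoid.closure_induction_right with
  | one => exact ⟨1, one_mem _, n + 1, le_rfl, by rw [descProd_of_le le_rfl, mul_one]⟩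
  | mul_right a _ y hy ih =>
    obtain ⟨i, hi, rfl⟩ := hy
    obtain ⟨u, hu, j, hj, rfl⟩ := ih
    have hi : i < n + 1 := hi
    rw [mul_assoc]
    rcases lt_trichotomy (i + 1) j with h | rfl | h
    · exact ⟨u * t i, mul_mem hu (mem_initialClosure (by omega)), j, hj, by
        rw [H.descProd_mul_of_lt h hK, mul_assoc]⟩
    · exact ⟨u, hu, i, by omega, by rw [descProd_mul_pred hi]⟩
    · rcases (Nat.lt_succ_iff.mp h).eq_or_lt with rfl | h
      · exact ⟨u, hu, j + 1, by omega, by rw [H.descProd_mul_self hi hK]⟩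
      · obtain ⟨i, rfl⟩ := Nat.exists_eq_add_one_of_ne_zero (show i ≠ 0 by omega)
        exact ⟨u * t i, mul_mem hu (mem_initialClosure (by omega)), j, hj, by
          rw [H.descProd_mul_of_gt (by omega) hi hK, mul_assoc]⟩

lemma map_descProd_apply {f : Q →* Equiv.Perm (Fin (K + 1))}
    (hf : ∀ i (h : i < K), f (t i) = Equiv.swap ⟨i, by omega⟩ ⟨i + 1, by omega⟩)
    {n j : ℕ} (hj : j ≤ n) (hK : n ≤ K) :
    f (descProd t n j) ⟨j, by omega⟩ = ⟨n, by omega⟩ := by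
  induction n with
  | zero =>
    obtain rfl : j = 0 := by omega
    simp [descProd]
  | succ n ih =>
    rcases Nat.le_succ_iff.mp hj with h | rfl
    · rw [descProd_succ h, map_mul, Equiv.Perm.mul_apply, ih h (by omega), hf n (by omega),
        Equiv.swap_apply_left]
    · rw [descProd_of_le le_rfl, map_one, Equiv.Perm.one_apply]

lemma map_initialClosure_apply {f : Q →* Equiv.Perm (Fin (K + 1))}
    (hf : ∀ i (h : i < K), f (t i) = Equiv.swap ⟨i, by omega⟩ ⟨i + 1, by omega⟩)
    {n : ℕ} {a : Q} (ha : a ∈ initialClosure t n) (x : Fin (K + 1)) (hx : n < x) :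
    f a x = x := by
  induction ha using Submonoid.closure_induction with
  | mem y hy =>
    obtain ⟨i, hi, rfl⟩ := hy
    have hi : i < n := hi
    rw [hf i (by omega)]
    apply Equiv.swap_apply_of_ne_of_ne <;> rw [Ne, Fin.ext_iff] <;> simp <;> omega
  | one => simp
  | mul a b _ _ iha ihb => rw [map_mul, Equiv.Perm.mul_apply, ihb, iha]

/-- A Coxeter system of type `A` maps faithfully to the symmetric group. -/
theorem IsCoxeterA.injOn (H : IsCoxeterA t K) {f : Q →* Equiv.Perm (Fin (K + 1))}
    (hf : ∀ i (h : i < K), f (t i) = Equiv.swap ⟨i, by omega⟩ ⟨i + 1, by omega⟩)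
    {n : ℕ} (hK : n ≤ K) :
    Set.InjOn f (initialClosure t n) := by
  induction n with
  | zero =>
    intro a ha b hb _
    have h0 : initialClosure t 0 = ⊥ := by simp [initialClosure]
    rw [h0] at ha hb
    rw [Submonoid.mem_bot.mp ha, Submonoid.mem_bot.mp hb]
  | succ n ih =>
    intro a ha b hb hab
    obtain ⟨u, hu, j, hj, rfl⟩ := H.exists_eq_mul_descProd hK ha
    obtain ⟨v, hv, k, hk, rfl⟩ := H.exists_eq_mul_descProd hK hb
    have key : ∀ w ∈ initialClosure t n, ∀ l (hl : l ≤ n + 1),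
        f (w * descProd t (n + 1) l) ⟨l, by omega⟩ = ⟨n + 1, by omega⟩ := fun w hw l hl => by
      rw [map_mul, Equiv.Perm.mul_apply, map_descProd_apply hf hl hK,
        map_initialClosure_apply hf hw _ (Nat.lt_succ_self n)]
    have h1 := key u hu j hj
    rw [hab, ← key v hv k hk] at h1
    obtain rfl : j = k := by simpa using (f _).injective h1
    rw [map_mul, map_mul] at hab
    rw [ih (by omega) hu hv (mul_right_cancel hab)]

end Coxeter

section Wreath

/-- The wreath product `M ≀ S_n` as a type carrying its monoid structure. -/
def Wreath (M : Type*) (n : ℕ) : Type _ := (Fin n → M) × Equiv.Perm (Fin n)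

variable {M : Type*} [Monoid M] {n : ℕ}

instance : Monoid (Wreath M n) where
  mul p q := wrMul p q
  one := ((fun _ => 1, Equiv.refl _) : (Fin n → M) × Equiv.Perm (Fin n))
  mul_assoc p q r := Prod.ext (funext fun _ => mul_assoc _ _ _) rfl
  one_mul p := Prod.ext (funext fun _ => one_mul _) rfl
  mul_one p := Prod.ext (funext fun _ => mul_one _) rfl

namespace Wreath

lemma mul_fst (p q : Wreath M n) (i : Fin n) : (p * q).1 i = p.1 i * q.1 (p.2 i) := rfl

/-- The embedding of the base `Mⁿ`. -/
def base : (Fin n → M) →* Wreath M n where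
  toFun a := (a, Equiv.refl _)
  map_one' := rfl
  map_mul' _ _ := rfl

/-- The projection to the symmetric group, made covariant for right-to-left composition. -/
def perm : Wreath M n →* Equiv.Perm (Fin n) where
  toFun p := p.2⁻¹
  map_one' := rfl
  map_mul' _ _ := rfl

/-- The embedding of the symmetric group, composed right to left. -/
def ofPerm : Equiv.Perm (Fin n) →* Wreath M n where
  toFun p := (1, p⁻¹)
  map_one' := rfl
  map_mul' _ _ := Prod.ext (funext fun _ => (mul_one _).symm) rfl

lemma base_mul_ofPerm (p : Wreath M n) : base p.1 * ofPerm p.2⁻¹ = p :=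
  Prod.ext (funext fun _ => mul_one _) rfl

lemma perm_base (a : Fin n → M) : perm (base a) = 1 := rfl

lemma ofPerm_mul_base (p : Equiv.Perm (Fin n)) (a : Fin n → M) :
    ofPerm p * base a = base (a ∘ ⇑p⁻¹) * ofPerm p :=
  Prod.ext (funext fun _ => (one_mul _).trans (mul_one _).symm) rfl

end Wreath

/-- The evaluation of words in the generators of `M ≀ S_n` as a homomorphism. -/
def Wreath.eval {X : Type*} (φ : FreeMonoid X →* M) (m : ℕ) :
    FreeMonoid ((X × Fin (m + 2)) ⊕ Fin (m + 1)) →* Wreath M (m + 2) :=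
  FreeMonoid.lift (Sum.elim
    (fun xi => Wreath.base (Pi.mulSingle xi.2 (φ (FreeMonoid.of xi.1))))
    (fun i => Wreath.ofPerm (Equiv.swap i.castSucc i.succ)))

lemma Wreath.eval_inl {X : Type*} (φ : FreeMonoid X →* M) (m : ℕ) (x : X) (i : Fin (m + 2)) :
    Wreath.eval φ m (FreeMonoid.of (Sum.inl (x, i))) =
      Wreath.base (Pi.mulSingle i (φ (FreeMonoid.of x))) := rfl

lemma Wreath.eval_inr {X : Type*} (φ : FreeMonoid X →* M) (m : ℕ) (i : Fin (m + 1)) :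
    Wreath.eval φ m (FreeMonoid.of (Sum.inr i)) =
      Wreath.ofPerm (Equiv.swap i.castSucc i.succ) := rfl

lemma Wreath.eval_of_eq_wrLetter {X : Type*} (φ : FreeMonoid X →* M) (m : ℕ)
    (y : (X × Fin (m + 2)) ⊕ Fin (m + 1)) :
    Wreath.eval φ m (FreeMonoid.of y) = wrLetter φ m y := by
  rcases y with ⟨x, i⟩ | i
  · exact Prod.ext (funext fun j => Pi.mulSingle_apply i (φ (FreeMonoid.of x)) j) rfl
  · exact Prod.ext rfl (Equiv.swap_inv _ _)

lemma Wreath.eval_eq_wrEval {X : Type*} (φ : FreeMonoid X →* M) (m : ℕ)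
    (w : FreeMonoid ((X × Fin (m + 2)) ⊕ Fin (m + 1))) :
    Wreath.eval φ m w = wrEval (wrLetter φ m) w := by
  induction w using FreeMonoid.recOn with
  | one => rw [map_one]; rfl
  | of_mul y w ih => rw [map_mul, ih, Wreath.eval_of_eq_wrLetter]; rfl

/-- The homomorphism on `M` induced by a homomorphism on the free monoid that identifies the
words with the same image in `M`. -/
noncomputable def liftOfKerLE {X Q : Type*} [Monoid Q] {φ : FreeMonoid X →* M}
    (hφ : Function.Surjective φ) (ψ : FreeMonoid X →* Q)
    (h : ∀ w v, φ w = φ v → ψ w = ψ v) : M →* Q where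
  toFun a := ψ (Function.surjInv hφ a)
  map_one' := by
    rw [← map_one ψ]
    exact h _ _ (by rw [Function.surjInv_eq hφ, map_one])
  map_mul' a b := by
    rw [← map_mul]
    exact h _ _ (by simp only [map_mul, Function.surjInv_eq hφ])

lemma liftOfKerLE_apply {X Q : Type*} [Monoid Q] {φ : FreeMonoid X →* M}
    (hφ : Function.Surjective φ) (ψ : FreeMonoid X →* Q)
    (h : ∀ w v, φ w = φ v → ψ w = ψ v) (w : FreeMonoid X) :
    liftOfKerLE hφ ψ h (φ w) = ψ w :=
  h _ _ (Function.surjInv_eq hφ _)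

lemma commute_lift {X Q : Type*} [Monoid Q] {c : Q} {g : X → Q}
    (h : ∀ x, Commute c (g x)) (w : FreeMonoid X) : Commute c (FreeMonoid.lift g w) := by
  induction w using FreeMonoid.recOn with
  | one => simp
  | of_mul x w ih => rw [map_mul, FreeMonoid.lift_eval_of]; exact (h x).mul_right ih

/-- A monoid generated by elements satisfying the defining relations of the wreath product,
with a compatible homomorphism `E` to `M ≀ S_n`, is isomorphic to it via `E`. -/
theorem Wreath.bijective_of_relations {X Q : Type*} [Monoid Q] {φ : FreeMonoid X →* M}
    (hφ : Function.Surjective φ) {m : ℕ} (g : Fin (m + 2) → X → Q) (s : Fin (m + 1) → Q)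
    (hgen : Submonoid.closure (Set.range (Sum.elim (fun xi : X × Fin (m + 2) => g xi.2 xi.1) s))
      = ⊤)
    (hrel : ∀ i w v, φ w = φ v → FreeMonoid.lift (g i) w = FreeMonoid.lift (g i) v)
    (hcomm : ∀ i j, i ≠ j → ∀ x y, Commute (g i x) (g j y))
    (hs : IsCoxeterA (fun i => if h : i < m + 1 then s ⟨i, h⟩ else 1) (m + 1))
    (hact : ∀ i k, ∃ k', ∀ x, s i * g k x = g k' x * s i)
    (E : Q →* Wreath M (m + 2))
    (hEg : ∀ i x, E (g i x) = Wreath.base (Pi.mulSingle i (φ (FreeMonoid.of x))))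
    (hEs : ∀ i, E (s i) = Wreath.ofPerm (Equiv.swap i.castSucc i.succ)) :
    Function.Bijective E := by
  let A : (Fin (m + 2) → M) →* Q :=
    MonoidHom.noncommPiCoprod (fun i => liftOfKerLE hφ (FreeMonoid.lift (g i)) (hrel i))
      fun i j hij a b => by
        obtain ⟨w, rfl⟩ := hφ a
        obtain ⟨v, rfl⟩ := hφ b
        simp only [liftOfKerLE_apply]
        exact commute_lift (fun y => (commute_lift (fun x => (hcomm i j hij x y).symm) w).symm) v
  have hA : ∀ i w, A (Pi.mulSingle i (φ w)) = FreeMonoid.lift (g i) w := fun i w => by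
    exact (MonoidHom.noncommPiCoprod_mulSingle _ i _).trans (liftOfKerLE_apply _ _ _ _)
  have hEA : E.comp A = Wreath.base := by
    refine MonoidHom.pi_ext fun i a => ?_
    obtain ⟨w, rfl⟩ := hφ a
    rw [MonoidHom.comp_apply, hA]
    induction w using FreeMonoid.recOn with
    | one => simp
    | of_mul x w ih =>
      rw [map_mul, map_mul, ih, map_mul, Pi.mulSingle_mul, map_mul, FreeMonoid.lift_eval_of, hEg]
  set t : ℕ → Q := fun i => if h : i < m + 1 then s ⟨i, h⟩ else 1
  have hts : ∀ i : Fin (m + 1), t i = s i := fun i => dif_pos i.2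
  have hEfst : ∀ u ∈ initialClosure t (m + 1), (E u).1 = fun _ => 1 := fun u hu => by
    induction hu using Submonoid.closure_induction with
    | mem y hy =>
      obtain ⟨i, hi, rfl⟩ := hy
      rw [hts ⟨i, hi⟩, hEs]
      rfl
    | one => rw [map_one]; rfl
    | mul a b _ _ iha ihb =>
      funext i
      rw [map_mul, Wreath.mul_fst, iha, ihb, mul_one]
  have hmove : ∀ u ∈ initialClosure t (m + 1), ∀ k, ∃ k', ∀ x, u * g k x = g k' x * u :=
    fun u hu => by
    induction hu using Submonoid.closure_induction with
    | mem y hy =>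
      obtain ⟨i, hi, rfl⟩ := hy
      rw [hts ⟨i, hi⟩]
      exact hact _
    | one => exact fun k => ⟨k, fun x => by rw [one_mul, mul_one]⟩
    | mul a b _ _ iha ihb =>
      intro k
      obtain ⟨k₁, h₁⟩ := ihb k
      obtain ⟨k₂, h₂⟩ := iha k₁
      exact ⟨k₂, fun x => by rw [mul_assoc, h₁, ← mul_assoc, h₂, mul_assoc]⟩
  have hnf : ∀ q : Q, ∃ a, ∃ u ∈ initialClosure t (m + 1), q = A a * u := fun q => by
    have hq : q ∈ Submonoid.closure
        (Set.range (Sum.elim (fun xi : X × Fin (m + 2) => g xi.2 xi.1) s)) := hgen ▸ trivial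
    induction hq using Submonoid.closure_induction_right with
    | one => exact ⟨1, 1, one_mem _, by simp⟩
    | mul_right q _ y hy ih =>
      obtain ⟨a, u, hu, rfl⟩ := ih
      obtain ⟨⟨x, k⟩ | i, rfl⟩ := hy
      · obtain ⟨k', hk'⟩ := hmove u hu k
        refine ⟨a * Pi.mulSingle k' (φ (FreeMonoid.of x)), u, hu, ?_⟩
        rw [map_mul, hA, FreeMonoid.lift_eval_of, mul_assoc, mul_assoc, ← hk']
        rfl
      · exact ⟨a, u * t i, mul_mem hu (mem_initialClosure i.2), by
          rw [hts, ← mul_assoc]; rfl⟩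
  have hf : ∀ i (h : i < m + 1), (Wreath.perm.comp E) (t i) =
      Equiv.swap ⟨i, by omega⟩ ⟨i + 1, by omega⟩ := fun i h => by
    rw [MonoidHom.comp_apply, hts ⟨i, h⟩, hEs]
    exact inv_inv _
  constructor
  · intro p q hpq
    obtain ⟨a, u, hu, rfl⟩ := hnf p
    obtain ⟨b, v, hv, rfl⟩ := hnf q
    have hE : ∀ a, E (A a) = Wreath.base a := DFunLike.congr_fun hEA
    rw [map_mul, map_mul, hE, hE] at hpq
    have hab : a = b := by
      funext i
      have := congrFun (congrArg Prod.fst hpq) i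
      rw [Wreath.mul_fst, Wreath.mul_fst, hEfst u hu, hEfst v hv, mul_one, mul_one] at this
      exact this
    have huv : u = v := hs.injOn hf le_rfl hu hv
      (by simpa only [MonoidHom.comp_apply, map_mul, Wreath.perm_base, one_mul] using
        congrArg Wreath.perm hpq)
    rw [hab, huv]
  · intro p
    rw [← MonoidHom.mem_mrange, ← Wreath.base_mul_ofPerm p]
    refine mul_mem ⟨A p.1, DFunLike.congr_fun hEA p.1⟩ ?_
    have hle : (⊤ : Submonoid _) ≤ (MonoidHom.mrange E).comap Wreath.ofPerm := by
      rw [← Equiv.Perm.mclosure_swap_castSucc_succ, Submonoid.closure_le]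
      rintro _ ⟨i, rfl⟩
      exact ⟨s i, hEs i⟩
    exact hle trivial

/-- A relation that holds in `M ≀ S_n` and contains its defining relations presents it. -/
theorem Wreath.presentation {X : Type*} {RM : FreeMonoid X → FreeMonoid X → Prop}
    {φ : FreeMonoid X →* M} (hφ : Function.Surjective φ)
    (hker : ∀ w v, φ w = φ v ↔ conGen RM w v) {m : ℕ}
    (R : FreeMonoid ((X × Fin (m + 2)) ⊕ Fin (m + 1)) →
      FreeMonoid ((X × Fin (m + 2)) ⊕ Fin (m + 1)) → Prop)
    (hsound : ∀ a b, R a b → Wreath.eval φ m a = Wreath.eval φ m b)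
    (hrel : ∀ w v i, RM w v → R (FreeMonoid.map (fun x => Sum.inl (x, i)) w)
      (FreeMonoid.map (fun x => Sum.inl (x, i)) v))
    (hcomm : ∀ x y i j, i ≠ j →
      R (FreeMonoid.of (Sum.inl (x, i)) * FreeMonoid.of (Sum.inl (y, j)))
        (FreeMonoid.of (Sum.inl (y, j)) * FreeMonoid.of (Sum.inl (x, i))))
    (hsq : ∀ i, R (FreeMonoid.of (Sum.inr i) * FreeMonoid.of (Sum.inr i)) 1)
    (hscomm : ∀ i j : Fin (m + 1), (i : ℕ) + 1 < j →
      R (FreeMonoid.of (Sum.inr i) * FreeMonoid.of (Sum.inr j))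
        (FreeMonoid.of (Sum.inr j) * FreeMonoid.of (Sum.inr i)))
    (hbraid : ∀ i j : Fin (m + 1), (i : ℕ) + 1 = j →
      R (FreeMonoid.of (Sum.inr i) * FreeMonoid.of (Sum.inr j) * FreeMonoid.of (Sum.inr i))
        (FreeMonoid.of (Sum.inr j) * FreeMonoid.of (Sum.inr i) * FreeMonoid.of (Sum.inr j)))
    (hact : ∀ i k, ∃ k', ∀ x, R (FreeMonoid.of (Sum.inr i) * FreeMonoid.of (Sum.inl (x, k)))
      (FreeMonoid.of (Sum.inl (x, k')) * FreeMonoid.of (Sum.inr i))) :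
    (∀ p, ∃ w, wrEval (wrLetter φ m) w = p) ∧
      ∀ w v, wrEval (wrLetter φ m) w = wrEval (wrLetter φ m) v ↔ conGen R w v := by
  let F := Wreath.eval φ m
  have hF : ∀ w, F w = wrEval (wrLetter φ m) w := Wreath.eval_eq_wrEval φ m
  let c := conGen R
  have hc : c ≤ Con.ker F := Con.conGen_le.mpr hsound
  have hR : ∀ {a b}, R a b → c.mk' a = c.mk' b :=
    fun h => (Con.eq c).mpr (ConGen.Rel.of _ _ h)
  have hbij : Function.Bijective (c.lift F hc) := by
    refine Wreath.bijective_of_relations hφ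
      (fun i x => c.mk' (FreeMonoid.of (Sum.inl (x, i))))
      (fun i => c.mk' (FreeMonoid.of (Sum.inr i))) ?_ ?_ ?_ ⟨?_, ?_, ?_⟩ ?_ _ ?_ ?_
    · have : (Sum.elim (fun xi : X × Fin (m + 2) => c.mk' (FreeMonoid.of (Sum.inl (xi.1, xi.2))))
          (fun i : Fin (m + 1) => c.mk' (FreeMonoid.of (Sum.inr i)))) =
          c.mk' ∘ FreeMonoid.of := by
        funext y
        rcases y with y | y <;> rfl
      rw [this, Set.range_comp, ← MonoidHom.map_mclosure, FreeMonoid.closure_range_of,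
        ← MonoidHom.mrange_eq_map, MonoidHom.mrange_eq_top]
      exact Con.mk'_surjective
    · intro i w v hwv
      have hlift : FreeMonoid.lift (fun x => c.mk' (FreeMonoid.of (Sum.inl (x, i)))) =
          c.mk'.comp (FreeMonoid.map fun x => Sum.inl (x, i)) := FreeMonoid.hom_eq fun _ => rfl
      rw [hlift]
      have hle : conGen RM ≤ Con.ker (c.mk'.comp (FreeMonoid.map fun x => Sum.inl (x, i))) :=
        Con.conGen_le.mpr fun a b hab => hR (hrel a b i hab)
      exact hle ((hker w v).mp hwv)
    · exact fun i j hij x y => hR (hcomm x y i j hij)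
    · intro i hi
      simp only [hi, dite_true]
      exact hR (hsq _)
    · intro i j hij hj
      simp only [hj, show i < m + 1 by omega, dite_true]
      exact hR (hscomm _ _ hij)
    · intro i hi
      simp only [hi, show i < m + 1 by omega, dite_true]
      exact hR (hbraid _ _ rfl)
    · intro i k
      obtain ⟨k', hk'⟩ := hact i k
      exact ⟨k', fun x => hR (hk' x)⟩
    · exact fun i x => rfl
    · exact fun i => rfl
  refine ⟨fun p => ?_, fun w v => ?_⟩
  · obtain ⟨q, hq⟩ := hbij.2 p
    obtain ⟨w, rfl⟩ := Con.mk'_surjective q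
    exact ⟨w, (hF w).symm.trans hq⟩
  · rw [← hF, ← hF]
    exact ⟨fun h => (Con.eq c).mp (hbij.1 h), fun h => hc h⟩

end Wreath

lemma swap_braid {α : Type*} [DecidableEq α] {a b c : α} (hab : a ≠ b) (hbc : b ≠ c)
    (hac : a ≠ c) : Equiv.swap a b * Equiv.swap b c * Equiv.swap a b =
      Equiv.swap b c * Equiv.swap a b * Equiv.swap b c := by
  rw [Equiv.swap_mul_swap_mul_swap hab hac, Equiv.swap_comm a b, Equiv.swap_comm b c,
    Equiv.swap_mul_swap_mul_swap hbc.symm hac.symm, Equiv.swap_comm]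

/-- Let `M` be a monoid with presentation `Mon⟨X_M | R_M⟩` via `φ_M` and
let `n = m + 2 ≥ 2`.  Then the wreath product `M ≀ S_n` has the monoid presentation with
generators `{x⁽ⁱ⁾} ∪ {s_1, …, s_{n-1}}` and relations (a) the copies `R_M⁽ⁱ⁾`,
(b) `x⁽ⁱ⁾y⁽ʲ⁾ = y⁽ʲ⁾x⁽ⁱ⁾` for `i ≠ j`, (c) the Coxeter relations, and
(d) `s_i x⁽ᵏ⁾ = x⁽ᵏ'⁾ s_i`: the evaluation map `Ψ` is surjective and its kernel is the
congruence generated by these relations. -/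
theorem stmt_19 {M : Type*} [Monoid M] {X : Type*}
    (RM : FreeMonoid X → FreeMonoid X → Prop) (φM : FreeMonoid X →* M)
    (hsurj : Function.Surjective φM)
    (hker : ∀ w v, φM w = φM v ↔ conGen RM w v) (m : ℕ) :
    (∀ p : (Fin (m + 2) → M) × Equiv.Perm (Fin (m + 2)),
      ∃ w : FreeMonoid ((X × Fin (m + 2)) ⊕ Fin (m + 1)), wrEval (wrLetter φM m) w = p) ∧
    (∀ w v : FreeMonoid ((X × Fin (m + 2)) ⊕ Fin (m + 1)),
      wrEval (wrLetter φM m) w = wrEval (wrLetter φM m) v ↔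
        conGen (fun a b : FreeMonoid ((X × Fin (m + 2)) ⊕ Fin (m + 1)) =>
          (∃ (w' v' : FreeMonoid X) (i : Fin (m + 2)), RM w' v' ∧
            a = FreeMonoid.map (fun x => Sum.inl (x, i)) w' ∧
            b = FreeMonoid.map (fun x => Sum.inl (x, i)) v') ∨
          (∃ (x y : X) (i j : Fin (m + 2)), i ≠ j ∧
            a = FreeMonoid.of (Sum.inl (x, i)) * FreeMonoid.of (Sum.inl (y, j)) ∧
            b = FreeMonoid.of (Sum.inl (y, j)) * FreeMonoid.of (Sum.inl (x, i))) ∨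
          (∃ i : Fin (m + 1),
            a = FreeMonoid.of (Sum.inr i) * FreeMonoid.of (Sum.inr i) ∧ b = 1) ∨
          (∃ i j : Fin (m + 1), ((i : ℕ) + 1 < (j : ℕ) ∨ (j : ℕ) + 1 < (i : ℕ)) ∧
            a = FreeMonoid.of (Sum.inr i) * FreeMonoid.of (Sum.inr j) ∧
            b = FreeMonoid.of (Sum.inr j) * FreeMonoid.of (Sum.inr i)) ∨
          (∃ i j : Fin (m + 1), ((i : ℕ) + 1 = (j : ℕ) ∨ (j : ℕ) + 1 = (i : ℕ)) ∧
            a = FreeMonoid.of (Sum.inr i) * FreeMonoid.of (Sum.inr j) *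
                  FreeMonoid.of (Sum.inr i) ∧
            b = FreeMonoid.of (Sum.inr j) * FreeMonoid.of (Sum.inr i) *
                  FreeMonoid.of (Sum.inr j)) ∨
          (∃ (x : X) (i : Fin (m + 1)) (k : Fin (m + 2)),
            a = FreeMonoid.of (Sum.inr i) * FreeMonoid.of (Sum.inl (x, k)) ∧
            b = FreeMonoid.of (Sum.inl (x,
                  if k = i.castSucc then i.succ
                  else if k = i.succ then i.castSucc else k)) *
                FreeMonoid.of (Sum.inr i))) w v) := by
  refine Wreath.presentation hsurj hker _ ?_ (fun w v i h => Or.inl ⟨w, v, i, h, rfl, rfl⟩)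
    (fun x y i j h => Or.inr (Or.inl ⟨x, y, i, j, h, rfl, rfl⟩))
    (fun i => Or.inr (Or.inr (Or.inl ⟨i, rfl, rfl⟩)))
    (fun i j h => Or.inr (Or.inr (Or.inr (Or.inl ⟨i, j, Or.inl h, rfl, rfl⟩))))
    (fun i j h => Or.inr (Or.inr (Or.inr (Or.inr (Or.inl ⟨i, j, Or.inl h, rfl, rfl⟩)))))
    (fun i k => ⟨_, fun x =>
      Or.inr (Or.inr (Or.inr (Or.inr (Or.inr ⟨x, i, k, rfl, rfl⟩))))⟩)
  rintro _ _ (⟨w, v, i, h, rfl, rfl⟩ | ⟨x, y, i, j, h, rfl, rfl⟩ | ⟨i, rfl, rfl⟩ |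
    ⟨i, j, h, rfl, rfl⟩ | ⟨i, j, h, rfl, rfl⟩ | ⟨x, i, k, rfl, rfl⟩)
  · have hlift : (Wreath.eval φM m).comp (FreeMonoid.map fun x => Sum.inl (x, i)) =
        (Wreath.base.comp (MonoidHom.mulSingle (fun _ => M) i)).comp φM :=
      FreeMonoid.hom_eq fun x => Wreath.eval_inl φM m x i
    have hw := DFunLike.congr_fun hlift
    simp only [MonoidHom.comp_apply] at hw
    rw [hw, hw, (hker w v).mpr (ConGen.Rel.of _ _ h)]
  all_goals simp only [map_mul, map_one, Wreath.eval_inl, Wreath.eval_inr]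
  · rw [← map_mul, ← map_mul, (Pi.mulSingle_commute h _ _).eq]
  · rw [← map_mul, Equiv.swap_mul_self, map_one]
  · rw [← map_mul, ← map_mul]
    congr 1
    refine (Equiv.Perm.disjoint_swap_swap ?_).commute.eq
    simp [Fin.ext_iff]
    omega
  · rw [← map_mul, ← map_mul, ← map_mul, ← map_mul]
    congr 1
    rcases h with h | h
    · rw [show j.castSucc = i.succ from Fin.ext h.symm]
      exact swap_braid (by simp [Fin.ext_iff]) (by simp [Fin.ext_iff]; omega)
        (by simp [Fin.ext_iff]; omega)
    · rw [show i.castSucc = j.succ from Fin.ext h.symm]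
      exact (swap_braid (by simp [Fin.ext_iff]) (by simp [Fin.ext_iff]; omega)
        (by simp [Fin.ext_iff]; omega)).symm
  · rw [← Equiv.swap_apply_def, Wreath.ofPerm_mul_base, Equiv.swap_inv]
    congr 2
    funext l
    simp [Pi.mulSingle_apply, Equiv.swap_apply_eq_iff]
end
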